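/- Under conditions (A1)–(A3), for φ equal to φ1 or φ2: for every ζ ∈ ℝ and every t ∈ [0,1], M_n(t, ζ) − M_n(t, 0) converges to 0 in probability as n → ∞; moreover, sup_{0≤t≤1} |M_n(t, ζ) − M_n(t, 0)| converges to 0 in probability. -/

import Mathlib

open MeasureTheory ProbabilityTheory Filter Set
open scoped ProbabilityTheory

noncomputable section

namespace TailCusum

variable {Ω : Type*} [MeasureSpace Ω]

/-- `φ₁(x) = 1{x > 0}`. -/
def phi1 (x : ℝ) : ℝ := if 0 < x then 1 else 0

/-- `φ₂(x) = x₊ = max {x, 0}`. -/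
def phi2 (x : ℝ) : ℝ := max x 0

/-- positive part -/
def pos (x : ℝ) : ℝ := max x 0

/-- A positive measurable function `g` is regularly varying at `∞` with index `ρ` if
`g(λ x)/g(x) → λ^ρ` as `x → ∞` for every `λ > 0`. -/
def RegularlyVarying (g : ℝ → ℝ) (ρ : ℝ) : Prop :=
  Measurable g ∧ ∀ lam : ℝ, 0 < lam →
    Tendsto (fun x => g (lam * x) / g x) atTop (nhds (lam ^ ρ))

/-- `l` is slowly varying at `∞`. -/
def SlowlyVarying (l : ℝ → ℝ) : Prop :=
  Measurable l ∧ ∀ lam : ℝ, 0 < lam →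
    Tendsto (fun x => l (lam * x) / l x) atTop (nhds 1)

/-- `κ(λ) = K ∫_1^λ t^(γ-1) dt`. -/
def kappaFun (K γ : ℝ) (lam : ℝ) : ℝ := K * ∫ t in (1:ℝ)..lam, t ^ (γ - 1)

/-- Second-order regular variation condition on the slowly varying function `l`
(the core of condition (A2)): `(l(λx)/l(x) - 1)/g(x) → κ(λ)` with
`κ(λ) = K ∫_1^λ t^(γ-1) dt`, `g` positive and regularly varying with index `γ ≤ 0`. -/
def SecondOrderRV (l g : ℝ → ℝ) (K γ : ℝ) : Prop :=
  γ ≤ 0 ∧ (∀ x, 0 < g x) ∧ RegularlyVarying g γ ∧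
  ∀ lam : ℝ, 0 < lam →
    Tendsto (fun x => (l (lam * x) / l x - 1) / g x) atTop (nhds (kappaFun K γ lam))

/-- distribution function of a law on `ℝ` -/
def df (μ : Measure ℝ) (x : ℝ) : ℝ := (μ (Iic x)).toReal

/-- tail distribution function `F̄(x) = μ(x, ∞)` -/
def tailDF (μ : Measure ℝ) (x : ℝ) : ℝ := (μ (Ioi x)).toReal

/-- the quantile-type function `b(x) = inf {y : F(y) ≥ 1 - x⁻¹}` -/
def quantileB (μ : Measure ℝ) (x : ℝ) : ℝ := sInf {y : ℝ | 1 - x⁻¹ ≤ df μ y}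

/-- `F̄(x) = x^(-α) l(x)` for `x > 0` with `l` slowly varying: Pareto-type tail. -/
def ParetoTail (μ : Measure ℝ) (α : ℝ) (l : ℝ → ℝ) : Prop :=
  SlowlyVarying l ∧ ∀ x : ℝ, 0 < x → tailDF μ x = x ^ (-α) * l x

/-- strict stationarity of a sequence of random variables -/
def IsStationary (X : ℕ → Ω → ℝ) : Prop :=
  ∀ j : ℕ,
    Measure.map (fun ω => fun i : ℕ => X (i + j) ω) (ℙ : Measure Ω)
      = Measure.map (fun ω => fun i : ℕ => X i ω) (ℙ : Measure Ω)

/-- strict stationarity, `ℤ`-indexed -/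
def IsStationaryZ (X : ℤ → Ω → ℝ) : Prop :=
  ∀ j : ℤ,
    Measure.map (fun ω => fun i : ℤ => X (i + j) ω) (ℙ : Measure Ω)
      = Measure.map (fun ω => fun i : ℤ => X i ω) (ℙ : Measure Ω)

/-- The β-mixing coefficient of the sequence `X` at lag `lag`, expressed as
the supremum over `m` of the total-variation distance between the joint law of
`(X_1, …, X_m)` and `(X_{m+lag+1}, X_{m+lag+2}, …)` and the product of the two laws. -/
def betaMix (X : ℕ → Ω → ℝ) (lag : ℕ) : ℝ :=
  ⨆ m : ℕ, ⨆ S : Subtype (MeasurableSet : Set ((Fin m → ℝ) × (ℕ → ℝ)) → Prop),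
    |((Measure.map
        (fun ω => ((fun i : Fin m => X ((i : ℕ) + 1) ω, fun i : ℕ => X (m + lag + 1 + i) ω)))
        (ℙ : Measure Ω)) S.1).toReal
      - (((Measure.map (fun ω => fun i : Fin m => X ((i : ℕ) + 1) ω) (ℙ : Measure Ω)).prod
          (Measure.map (fun ω => fun i : ℕ => X (m + lag + 1 + i) ω) (ℙ : Measure Ω))) S.1).toReal|

/-- The tail sample fraction condition: `k → ∞` and `k = o(n)`. -/
def TailFraction (k : ℕ → ℕ) : Prop :=
  Tendsto (fun n : ℕ => (k n : ℝ)) atTop atTop ∧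
    Tendsto (fun n : ℕ => (k n : ℝ) / n) atTop (nhds 0)

/-- Condition (A1): `(n / r_n) β([ε r_n]) → 0` for every `ε > 0`, and `r_n² = o(k)`. -/
def CondA1 (X : ℕ → Ω → ℝ) (k r : ℕ → ℕ) : Prop :=
  (∀ n, 0 < r n) ∧
  (∀ ε : ℝ, 0 < ε →
    Tendsto (fun n : ℕ => ((n : ℝ) / r n) * betaMix X ⌊ε * r n⌋₊) atTop (nhds 0)) ∧
  Tendsto (fun n : ℕ => ((r n : ℝ) ^ 2 / k n)) atTop (nhds 0)

/-- Condition (A2): second-order regular variation of `l` plus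
`√k · g(b(n/k)) → A ∈ ℝ`. -/
def CondA2 (l g : ℝ → ℝ) (K γ A : ℝ) (b : ℝ → ℝ) (k : ℕ → ℕ) : Prop :=
  SecondOrderRV l g K γ ∧
    Tendsto (fun n : ℕ => Real.sqrt (k n) * g (b ((n : ℝ) / k n))) atTop (nhds A)

/-- covariance of two real random variables -/
def cov (f g : Ω → ℝ) : ℝ :=
  ∫ ω, (f ω - ∫ ω', f ω') * (g ω - ∫ ω', g ω')

/-- pairs `1 ≤ i < j ≤ N` -/
def pairsUpTo (N : ℕ) : Finset (ℕ × ℕ) :=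
  ((Finset.Icc 1 N) ×ˢ (Finset.Icc 1 N)).filter fun p => p.1 < p.2

/-- Condition (A3): existence of the limits `χ` and `ω` of the normalized sums of
covariances, for every `0 < ε < 1`. -/
def CondA3 (X : ℕ → Ω → ℝ) (b : ℝ → ℝ) (k r : ℕ → ℕ) (α χ ωc : ℝ) : Prop :=
  0 ≤ χ ∧ 0 ≤ ωc ∧
  ∀ ε : ℝ, 0 < ε → ε < 1 →
    (Tendsto (fun n : ℕ =>
        (2 * α ^ 2 * n / ((⌊ε * r n⌋₊ : ℝ) * k n)) *
          ∑ p ∈ pairsUpTo ⌊ε * r n⌋₊,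
            cov (fun ω => pos (Real.log (X p.1 ω) - Real.log (b ((n : ℝ) / k n))))
                (fun ω => pos (Real.log (X p.2 ω) - Real.log (b ((n : ℝ) / k n)))))
      atTop (nhds χ)) ∧
    (Tendsto (fun n : ℕ =>
        (2 * (n : ℝ) / ((⌊ε * r n⌋₊ : ℝ) * k n)) *
          ∑ p ∈ pairsUpTo ⌊ε * r n⌋₊,
            cov (fun ω => if b ((n : ℝ) / k n) < X p.1 ω then (1 : ℝ) else 0)
                (fun ω => if b ((n : ℝ) / k n) < X p.2 ω then (1 : ℝ) else 0))
      atTop (nhds ωc))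

/-- the `k`-th largest value among `X_1, …, X_n` -/
def orderStat (n k : ℕ) (X : ℕ → Ω → ℝ) (ω : Ω) : ℝ :=
  sInf {x : ℝ | ((Finset.Icc 1 n).filter fun i => x < X i ω).card < k}

/-- `|Σ_{i=1}^l Y_i - (l/n) Σ_{i=1}^n Y_i|` -/
def cusumAt (n : ℕ) (Y : ℕ → ℝ) (l : ℕ) : ℝ :=
  |∑ i ∈ Finset.Icc 1 l, Y i - ((l : ℝ) / n) * ∑ i ∈ Finset.Icc 1 n, Y i|

/-- The cusum statistic `T_n(φ)` with random threshold `X_(k)`. -/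
def cusum (n k : ℕ) (X : ℕ → Ω → ℝ) (φ : ℝ → ℝ) (ω : Ω) : ℝ :=
  (Real.sqrt k)⁻¹ *
    ⨆ l ∈ Finset.Icc 1 n,
      cusumAt n (fun i => φ (Real.log (X i ω) - Real.log (orderStat n k X ω))) l

/-- The cusum statistic with deterministic threshold `b(n/k)`. -/
def cusumDet (n k : ℕ) (X : ℕ → Ω → ℝ) (φ : ℝ → ℝ) (b : ℝ → ℝ) (ω : Ω) : ℝ :=
  (Real.sqrt k)⁻¹ *
    ⨆ l ∈ Finset.Icc 1 n,
      cusumAt n (fun i => φ (Real.log (X i ω) - Real.log (b ((n : ℝ) / k)))) l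

/-- convergence in distribution (weak convergence of laws) of real random variables to
a real random variable `Z` defined on a possibly different probability space -/
def TendstoInDist {Ω' : Type*} [MeasureSpace Ω'] (Y : ℕ → Ω → ℝ) (Z : Ω' → ℝ) : Prop :=
  ∀ f : ℝ → ℝ, Continuous f → (∃ C, ∀ x, |f x| ≤ C) →
    Tendsto (fun n : ℕ => ∫ ω, f (Y n ω)) atTop (nhds (∫ ω, f (Z ω)))

/-- convergence in distribution to a law `μ` on `ℝ` -/
def TendstoInLaw (Y : ℕ → Ω → ℝ) (μ : Measure ℝ) : Prop :=
  ∀ f : ℝ → ℝ, Continuous f → (∃ C, ∀ x, |f x| ≤ C) →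
    Tendsto (fun n : ℕ => ∫ ω, f (Y n ω)) atTop (nhds (∫ x, f x ∂μ))

/-- bounded in probability (`O_P(1)`) -/
def BddInProb (Y : ℕ → Ω → ℝ) : Prop :=
  ∀ ε : ℝ, 0 < ε → ∃ C : ℝ, ∀ᶠ n in atTop,
    ((ℙ : Measure Ω) {ω | C < |Y n ω|}).toReal < ε

/-- divergence to `+∞` in probability -/
def DivergesInProb (Y : ℕ → Ω → ℝ) : Prop :=
  ∀ C : ℝ, Tendsto (fun n : ℕ => ((ℙ : Measure Ω) {ω | Y n ω ≤ C}).toReal) atTop (nhds 0)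

/-- standard Brownian motion on `[0, ∞)` -/
structure IsStdBrownianMotion {Ω' : Type*} [MeasureSpace Ω'] (B : ℝ → Ω' → ℝ) : Prop where
  isProb : IsProbabilityMeasure (ℙ : Measure Ω')
  meas : ∀ t, Measurable (B t)
  start : ∀ᵐ ω ∂(ℙ : Measure Ω'), B 0 ω = 0
  gauss_incr : ∀ s t : ℝ, 0 ≤ s → s ≤ t →
    Measure.map (fun ω => B t ω - B s ω) (ℙ : Measure Ω')
      = gaussianReal 0 (Real.toNNReal (t - s))
  indep_incr : ∀ (n : ℕ) (ts : ℕ → ℝ), (∀ i, 0 ≤ ts i) → Monotone ts →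
    iIndepFun (m := fun _ => Real.measurableSpace)
      (fun i : Fin n => fun ω => B (ts ((i : ℕ) + 1)) ω - B (ts (i : ℕ)) ω)
      (ℙ : Measure Ω')

/-- `sup_{0 ≤ t ≤ 1} |B°(t)|` where `B°(t) = B(t) - t B(1)` is the Brownian bridge
associated with the Brownian motion `B` -/
def supAbsBrownianBridge {Ω' : Type*} [MeasureSpace Ω'] (B : ℝ → Ω' → ℝ) (ω : Ω') : ℝ :=
  ⨆ t : Icc (0 : ℝ) 1, |B (t : ℝ) ω - (t : ℝ) * B 1 ω|

/-- `A_i(ζ) = φ(log X_i - log b(n/k) + ζ/√k)` -/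
def An (X : ℕ → Ω → ℝ) (b : ℝ → ℝ) (φ : ℝ → ℝ) (n k : ℕ) (ζ : ℝ) (i : ℕ) (ω : Ω) : ℝ :=
  φ (Real.log (X i ω) - Real.log (b ((n : ℝ) / k)) + ζ / Real.sqrt k)

/-- the tail sequential process `M_n(t, ζ) = k^{-1/2} Σ_{i=1}^{[nt]} (A_i(ζ) - E A_1(ζ))` -/
def Mn (X : ℕ → Ω → ℝ) (b : ℝ → ℝ) (φ : ℝ → ℝ) (n k : ℕ) (t ζ : ℝ) (ω : Ω) : ℝ :=
  (Real.sqrt k)⁻¹ * ∑ i ∈ Finset.Icc 1 ⌊(n : ℝ) * t⌋₊,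
    (An X b φ n k ζ i ω - ∫ ω', An X b φ n k ζ 1 ω')

/-- residual `ξ̂_i = X_i - Σ_{j=1}^p φ̂_j X_{i-j}` of an AR(p) fit -/
def residual (p : ℕ) (X : ℤ → Ω → ℝ) (φh : Ω → Fin p → ℝ) (i : ℕ) (ω : Ω) : ℝ :=
  X i ω - ∑ j : Fin p, φh ω j * X ((i : ℤ) - ((j : ℕ) + 1)) ω

/-- absolute residual `Ẑ_i = |ξ̂_i|` -/
def Zhat (p : ℕ) (X : ℤ → Ω → ℝ) (φh : Ω → Fin p → ℝ) (i : ℕ) (ω : Ω) : ℝ :=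
  |residual p X φh i ω|

/-- stationarity of the restriction of `Y` to the segment of indices `[a, b]` -/
def SegStationary (a b : ℕ) (Y : ℕ → Ω → ℝ) : Prop :=
  ∀ (m : ℕ) (s : Fin m → ℕ) (j : ℕ), (∀ q, a ≤ s q ∧ s q + j ≤ b) →
    Measure.map (fun ω => fun q : Fin m => Y (s q + j) ω) (ℙ : Measure Ω)
      = Measure.map (fun ω => fun q : Fin m => Y (s q) ω) (ℙ : Measure Ω)

/-- the row-wise mixing coefficient
`β_n(l) = sup_m sup {|P(A∩B) - P(A)P(B)| : A ∈ σ(Y_i : m+l+1 ≤ i ≤ n), B ∈ σ(Y_1,…,Y_m)}` -/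
def betaMixRow (n : ℕ) (Y : ℕ → Ω → ℝ) (lag : ℕ) : ℝ :=
  ⨆ m : ℕ, ⨆ As : Subtype (MeasurableSet : Set (Fin (n - (m + lag)) → ℝ) → Prop),
    ⨆ Bs : Subtype (MeasurableSet : Set (Fin m → ℝ) → Prop),
      |((ℙ : Measure Ω)
          (((fun ω => fun i : Fin (n - (m + lag)) => Y (m + lag + 1 + (i : ℕ)) ω) ⁻¹' As.1)
            ∩ ((fun ω => fun i : Fin m => Y ((i : ℕ) + 1) ω) ⁻¹' Bs.1))).toReal
        - ((ℙ : Measure Ω)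
            ((fun ω => fun i : Fin (n - (m + lag)) => Y (m + lag + 1 + (i : ℕ)) ω) ⁻¹' As.1)).toReal
          * ((ℙ : Measure Ω)
            ((fun ω => fun i : Fin m => Y ((i : ℕ) + 1) ω) ⁻¹' Bs.1)).toReal|

/-- Kolmogorov's maximal inequality for bounded martingale differences. -/
theorem measureReal_exists_le_abs_sum_martingaleDiff {Ω : Type*} {m0 : MeasurableSpace Ω}
    {μ : Measure Ω} [IsProbabilityMeasure μ] (𝒢 : Filtration ℕ m0) (D : ℕ → Ω → ℝ)
    (hD : ∀ p, StronglyMeasurable[𝒢 (p + 1)] (D p)) (R : ℝ)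
    (hR : ∀ p, ∀ᵐ ω ∂μ, |D p ω| ≤ R) (hD0 : ∀ p, μ[D p | 𝒢 p] =ᵐ[μ] 0)
    (v : ℝ) (hv : ∀ p, ∫ ω, D p ω ^ 2 ∂μ ≤ v) (m : ℕ) {ε : ℝ} (hε : 0 < ε) :
    μ.real {ω | ∃ P ≤ m, ε ≤ |∑ p ∈ Finset.range P, D p ω|} ≤ m * v / ε ^ 2 := by
  set T : ℕ → Ω → ℝ := fun P ω => ∑ p ∈ Finset.range P, D p ω with hT
  have hTsucc : ∀ P, T (P + 1) = T P + D P := fun P => by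
    ext ω; simp [hT, Finset.sum_range_succ]
  have hTm : ∀ P, StronglyMeasurable[𝒢 P] (T P) := by
    intro P
    refine Finset.stronglyMeasurable_fun_sum _ fun p hp => ?_
    exact (hD p).mono (𝒢.mono (Finset.mem_range.1 hp))
  have hTb : ∀ P, ∀ᵐ ω ∂μ, |T P ω| ≤ P * R := by
    intro P
    filter_upwards [ae_all_iff.2 hR] with ω h
    calc |T P ω| ≤ ∑ p ∈ Finset.range P, |D p ω| := Finset.abs_sum_le_sum_abs _ _
      _ ≤ ∑ p ∈ Finset.range P, R := Finset.sum_le_sum fun p _ => h p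
      _ = P * R := by simp
  have hDm0 : ∀ p, AEStronglyMeasurable (D p) μ := fun p =>
    ((hD p).mono (𝒢.le _)).aestronglyMeasurable
  have hTm0 : ∀ p, AEStronglyMeasurable (T p) μ := fun p =>
    ((hTm p).mono (𝒢.le _)).aestronglyMeasurable
  have hDint : ∀ p, Integrable (D p) μ := fun p => Integrable.of_bound (hDm0 p) R (hR p)
  have hTint : ∀ p, Integrable (T p) μ := fun p => Integrable.of_bound (hTm0 p) _ (hTb p)
  have hTD : ∀ p, Integrable (T p * D p) μ := fun p =>
    (hDint p).bdd_mul (hTm0 p) (hTb p)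
  have hDD : ∀ p, Integrable (D p * D p) μ := fun p =>
    (hDint p).bdd_mul (hDm0 p) (hR p)
  have hTT : ∀ p, Integrable (T p * T p) μ := fun p =>
    (hTint p).bdd_mul (hTm0 p) (hTb p)
  have hcross : ∀ p, μ[T p * D p | 𝒢 p] =ᵐ[μ] 0 := by
    intro p
    filter_upwards [condExp_mul_of_stronglyMeasurable_left (hTm p) (hTD p) (hDint p), hD0 p]
      with ω h1 h2
    simp [h1, h2]
  have hsq : ∀ p, T (p + 1) * T (p + 1) - T p * T p = (2 : ℝ) • (T p * D p) + D p * D p := by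
    intro p
    rw [hTsucc]; ext ω; simp; ring
  have hsub : Submartingale (fun p => T p * T p) 𝒢 μ := by
    refine submartingale_of_condExp_sub_nonneg_nat (fun p => (hTm p).mul (hTm p)) hTT ?_
    intro p
    rw [hsq]
    have h1 : 0 ≤ᵐ[μ] μ[D p * D p | 𝒢 p] :=
      condExp_nonneg (ae_of_all _ fun ω => mul_self_nonneg _)
    filter_upwards [condExp_add ((hTD p).smul (2 : ℝ)) (hDD p) (𝒢 p),
      condExp_smul (2 : ℝ) (T p * D p) (𝒢 p) (μ := μ), hcross p, h1] with ω h2 h3 h4 h5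
    rw [h2]
    simp only [Pi.add_apply, h3, Pi.smul_apply, h4, Pi.zero_apply] at h5 ⊢
    simpa using h5
  have hE : ∀ P : ℕ, ∫ ω, (T P * T P) ω ∂μ ≤ P * v := by
    intro P
    induction P with
    | zero => simp [hT]
    | succ P ih =>
      have h0 : T (P + 1) * T (P + 1) = T P * T P + ((2 : ℝ) • (T P * D P) + D P * D P) := by
        rw [← hsq]; ring
      have h1 : ∫ ω, (T P * D P) ω ∂μ = 0 := by
        rw [← integral_condExp (𝒢.le P), integral_congr_ae (hcross P)]; simp
      rw [h0, integral_add' (hTT P) (((hTD P).smul (2 : ℝ)).add (hDD P)),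
        integral_add' ((hTD P).smul (2 : ℝ)) (hDD P)]
      have h2 : ∫ ω, ((2 : ℝ) • (T P * D P)) ω ∂μ = 0 := by
        have : ∫ ω, ((2 : ℝ) • (T P * D P)) ω ∂μ = ∫ ω, (2 : ℝ) • (T P * D P) ω ∂μ := rfl
        rw [this, integral_smul, h1]; simp
      have h3 : ∫ ω, (D P * D P) ω ∂μ ≤ v := by
        simpa [sq] using hv P
      push_cast
      linarith
  have hmax := maximal_ineq hsub (fun p ω => mul_self_nonneg _) (ε := (ε ^ 2).toNNReal) m
  have hεc : ((ε ^ 2).toNNReal : ℝ) = ε ^ 2 := Real.coe_toNNReal _ (by positivity)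
  set S := {ω | ((ε ^ 2).toNNReal : ℝ) ≤ (Finset.range (m + 1)).sup'
    Finset.nonempty_range_add_one fun k => (T k * T k) ω} with hS
  have hsubset : {ω | ∃ P ≤ m, ε ≤ |∑ p ∈ Finset.range P, D p ω|} ⊆ S := by
    rintro ω ⟨P, hP, h⟩
    simp only [hS, mem_ofPred_eq, hεc]
    refine le_trans ?_ (Finset.le_sup' _ (Finset.mem_range.2 (Nat.lt_succ_of_le hP)))
    have h' : ε ≤ |T P ω| := h
    simp only [Pi.mul_apply]
    rw [← abs_mul_abs_self (T P ω)]
    nlinarith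
  have hle : ∫ ω in S, (T m * T m) ω ∂μ ≤ m * v :=
    (setIntegral_le_integral (hTT m) (ae_of_all _ fun ω => mul_self_nonneg _)).trans (hE m)
  have hmv : 0 ≤ m * v := (integral_nonneg fun ω => mul_self_nonneg _).trans (hE m)
  have h1 : ε ^ 2 * μ.real S ≤ m * v := by
    have := ENNReal.toReal_mono ENNReal.ofReal_ne_top (hmax.trans (ENNReal.ofReal_le_ofReal hle))
    rw [ENNReal.toReal_ofReal hmv, ENNReal.toReal_mul] at this
    simpa [hεc, Measure.real] using this
  calc _ ≤ μ.real S := measureReal_mono hsubset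
    _ ≤ m * v / ε ^ 2 := by rw [le_div_iff₀ (by positivity)]; linarith

/-- A maximal inequality for the partial sums of adapted bounded variables, with the bias
measured by the `L¹` norms of the conditional expectations given the past. -/
theorem measureReal_exists_le_abs_sum_adapted {Ω : Type*} {m0 : MeasurableSpace Ω}
    {μ : Measure Ω} [IsProbabilityMeasure μ] (𝒢 : Filtration ℕ m0) (W : ℕ → Ω → ℝ)
    (hW : ∀ p, StronglyMeasurable[𝒢 (p + 1)] (W p)) (M : ℝ) (hM : 0 ≤ M)
    (hWM : ∀ p ω, |W p ω| ≤ M) (v : ℝ) (hv : ∀ p, ∫ ω, |W p ω| ∂μ ≤ v)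
    (β : ℝ) (hβ : ∀ p, ∫ ω, |(μ[W p | 𝒢 p]) ω| ∂μ ≤ β) (m : ℕ) {ε : ℝ} (hε : 0 < ε) :
    μ.real {ω | ∃ P ≤ m, 2 * ε ≤ |∑ p ∈ Finset.range P, W p ω|}
      ≤ m * (4 * M * v) / ε ^ 2 + m * β / ε := by
  set D : ℕ → Ω → ℝ := fun p => W p - μ[W p | 𝒢 p] with hDdef
  have hWint : ∀ p, Integrable (W p) μ := fun p =>
    Integrable.of_bound ((hW p).mono (𝒢.le _)).aestronglyMeasurable M (ae_of_all _ (hWM p))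
  have hcond : ∀ p, ∀ᵐ ω ∂μ, |(μ[W p | 𝒢 p]) ω| ≤ M := fun p =>
    ae_bdd_abs_condExp_of_ae_bdd_abs (ae_of_all μ (hWM p))
  have hDb : ∀ p, ∀ᵐ ω ∂μ, |D p ω| ≤ 2 * M := fun p => by
    filter_upwards [hcond p] with ω h
    calc |D p ω| ≤ |W p ω| + |(μ[W p | 𝒢 p]) ω| := abs_sub _ _
      _ ≤ 2 * M := by linarith [hWM p ω]
  have hDint : ∀ p, Integrable (D p) μ := fun p => (hWint p).sub integrable_condExp
  have hdiff := measureReal_exists_le_abs_sum_martingaleDiff 𝒢 D (μ := μ)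
    (fun p => (hW p).sub (stronglyMeasurable_condExp.mono (𝒢.mono p.le_succ))) (2 * M) hDb
    (fun p => by
      have h2 := condExp_of_stronglyMeasurable (𝒢.le p)
        (stronglyMeasurable_condExp (f := W p) (μ := μ)) integrable_condExp
      filter_upwards [condExp_sub (hWint p) (integrable_condExp (m := 𝒢 p) (f := W p)) (𝒢 p)]
        with ω h1
      rw [h1]; simp [h2])
    (4 * M * v)
    (fun p => by
      calc ∫ ω, D p ω ^ 2 ∂μ ≤ ∫ ω, 2 * M * |D p ω| ∂μ := by
            refine integral_mono_of_nonneg (ae_of_all _ fun ω => sq_nonneg _)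
              ((hDint p).abs.const_mul _) ?_
            filter_upwards [hDb p] with ω h
            rw [← sq_abs]
            nlinarith [abs_nonneg (D p ω)]
        _ = 2 * M * ∫ ω, |D p ω| ∂μ := integral_const_mul _ _
        _ ≤ 2 * M * (2 * v) := by
            gcongr
            calc ∫ ω, |D p ω| ∂μ ≤ ∫ ω, (|W p ω| + |(μ[W p | 𝒢 p]) ω|) ∂μ :=
                  integral_mono (hDint p).abs ((hWint p).abs.add integrable_condExp.abs)
                    fun ω => abs_sub _ _
              _ = ∫ ω, |W p ω| ∂μ + ∫ ω, |(μ[W p | 𝒢 p]) ω| ∂μ :=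
                  integral_add (hWint p).abs integrable_condExp.abs
              _ ≤ 2 * v := by linarith [hv p, integral_abs_condExp_le (m := 𝒢 p) (μ := μ) (W p)]
        _ = 4 * M * v := by ring) m hε
  have hbias : μ.real {ω | ε ≤ ∑ p ∈ Finset.range m, |(μ[W p | 𝒢 p]) ω|} ≤ m * β / ε := by
    rw [le_div_iff₀ hε, mul_comm]
    refine (mul_meas_ge_le_integral_of_nonneg
      (ae_of_all _ fun ω => Finset.sum_nonneg fun p _ => abs_nonneg _)
      (integrable_finsetSum _ fun p _ => integrable_condExp.abs) ε).trans ?_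
    rw [integral_finsetSum _ fun p _ => integrable_condExp.abs]
    exact (Finset.sum_le_sum fun p _ => hβ p).trans (by simp)
  refine le_trans (measureReal_mono ?_) ((measureReal_union_le _ _).trans (add_le_add hdiff hbias))
  rintro ω ⟨P, hP, h⟩
  by_contra hcon
  simp only [mem_union, mem_ofPred_eq, not_or, not_exists, not_and, not_le] at hcon
  have h1 := hcon.1 P hP
  have h2 : |∑ p ∈ Finset.range P, (μ[W p | 𝒢 p]) ω| ≤ ∑ p ∈ Finset.range m, |(μ[W p | 𝒢 p]) ω| :=
    (Finset.abs_sum_le_sum_abs _ _).trans (Finset.sum_le_sum_of_subset_of_nonneg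
      (Finset.range_subset_range.2 hP) fun _ _ _ => abs_nonneg _)
  have h3 : ∑ p ∈ Finset.range P, W p ω
      = ∑ p ∈ Finset.range P, D p ω + ∑ p ∈ Finset.range P, (μ[W p | 𝒢 p]) ω := by
    rw [← Finset.sum_add_distrib]; simp [hDdef]
  rw [h3] at h
  linarith [abs_add_le (∑ p ∈ Finset.range P, D p ω) (∑ p ∈ Finset.range P, (μ[W p | 𝒢 p]) ω),
    hcon.2]

/-- Dependence bound for the conditional expectation of a bounded centred variable. -/
theorem integral_abs_condExp_le_of_forall_abs_sub_le {Ω : Type*} {m m' m0 : MeasurableSpace Ω}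
    {μ : Measure Ω} [IsProbabilityMeasure μ] (hm : m ≤ m0) (hm' : m' ≤ m0) {W : Ω → ℝ}
    (hW : Measurable[m'] W) {M β : ℝ} (hM : 0 ≤ M) (hWM : ∀ ω, |W ω| ≤ M)
    (hW0 : ∫ ω, W ω ∂μ = 0)
    (hβ : ∀ A B, MeasurableSet[m] A → MeasurableSet[m'] B →
      |μ.real (A ∩ B) - μ.real A * μ.real B| ≤ β) :
    ∫ ω, |(μ[W | m]) ω| ∂μ ≤ 4 * M * β := by
  set Z := μ[W | m] with hZ
  have hWm0 : Measurable W := hW.mono hm' le_rfl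
  have hWint : Integrable W μ :=
    Integrable.of_bound hWm0.aestronglyMeasurable M (ae_of_all _ hWM)
  have hZint : Integrable Z μ := integrable_condExp
  set A := {ω | 0 ≤ Z ω} with hAdef
  have hA : MeasurableSet[m] A :=
    measurableSet_le measurable_const stronglyMeasurable_condExp.measurable
  have hA0 : MeasurableSet A := hm _ hA
  have h1 : ∫ ω, |Z ω| ∂μ = 2 * ∫ ω in A, W ω ∂μ := by
    have h2 : ∀ ω, |Z ω| = 2 * A.indicator Z ω - Z ω := by
      intro ω
      by_cases h : 0 ≤ Z ω
      · rw [indicator_of_mem (show ω ∈ A from h), abs_of_nonneg h]; ring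
      · rw [indicator_of_notMem (show ω ∉ A from h), abs_of_neg (not_le.1 h)]; ring
    simp_rw [h2]
    rw [integral_sub ((hZint.indicator hA0).const_mul 2) hZint, integral_const_mul,
      integral_indicator hA0, integral_condExp hm, hW0, setIntegral_condExp hm hWint hA, sub_zero]
  set f : Ω → ℝ := fun ω => W ω + M with hf
  have hfm : Measurable f := hWm0.add_const M
  have hf0 : ∀ ω, 0 ≤ f ω := fun ω => by linarith [neg_abs_le (W ω), hWM ω]
  have hfM : ∀ ω, f ω ≤ 2 * M := fun ω => by
    simp only [hf]; linarith [le_abs_self (W ω), hWM ω]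
  have hfint : Integrable f μ := hWint.add (integrable_const M)
  have hmeas : ∀ t, MeasurableSet {ω | t ≤ f ω} := fun t => measurableSet_le measurable_const hfm
  have hmeas' : ∀ t, MeasurableSet[m'] {ω | t ≤ f ω} := fun t =>
    measurableSet_le (f := fun _ : Ω => t) measurable_const (hW.add_const M)
  have e1 : ∫ ω in A, f ω ∂μ = ∫ t in Ioc 0 (2 * M), μ.real (A ∩ {ω | t ≤ f ω}) := by
    rw [(hfint.restrict (s := A)).integral_eq_integral_Ioc_meas_le (ae_of_all _ hf0)
      (ae_of_all _ hfM)]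
    simp_rw [measureReal_restrict_apply (hmeas _), inter_comm]
  have e2 : ∫ ω, f ω ∂μ = ∫ t in Ioc 0 (2 * M), μ.real {ω | t ≤ f ω} :=
    hfint.integral_eq_integral_Ioc_meas_le (ae_of_all _ hf0) (ae_of_all _ hfM)
  have hint : ∀ B : Set Ω, IntegrableOn (fun t => μ.real (B ∩ {ω | t ≤ f ω})) (Ioc 0 (2 * M)) := by
    intro B
    have hanti : Antitone fun t => μ.real (B ∩ {ω | t ≤ f ω}) := fun s t hst =>
      measureReal_mono (inter_subset_inter_right _ fun ω h => hst.trans h)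
    refine Integrable.of_bound hanti.measurable.aestronglyMeasurable 1 (ae_of_all _ fun t => ?_)
    rw [Real.norm_of_nonneg measureReal_nonneg]
    exact measureReal_le_one
  have e3 : ∫ ω in A, f ω ∂μ = ∫ ω in A, W ω ∂μ + μ.real A * M := by
    rw [hf, integral_add hWint.integrableOn (integrable_const M)]; simp
  have e4 : ∫ ω, f ω ∂μ = M := by
    rw [hf, integral_add hWint (integrable_const M), hW0]; simp
  have e5 : ∫ ω in A, W ω ∂μ = ∫ t in Ioc 0 (2 * M),
      (μ.real (A ∩ {ω | t ≤ f ω}) - μ.real A * μ.real {ω | t ≤ f ω}) := by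
    have hu := hint univ
    simp only [univ_inter] at hu
    rw [integral_sub (hint A) (hu.const_mul _), integral_const_mul, ← e1, ← e2, e3, e4]
    ring
  have e6 : ∫ ω in A, W ω ∂μ ≤ β * (2 * M) := by
    rw [e5]
    refine (le_abs_self _).trans ?_
    refine (norm_setIntegral_le_of_norm_le_const (C := β) measure_Ioc_lt_top fun t _ =>
      (Real.norm_eq_abs _).trans_le (hβ A _ hA (hmeas' t))).trans ?_
    simp [hM]
  rw [h1]; linarith

/-- The σ-algebra generated by `X₁, …, X_N`. -/
abbrev past {Ω : Type*} (X : ℕ → Ω → ℝ) (N : ℕ) : MeasurableSpace Ω :=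
  MeasurableSpace.comap (fun ω => fun i : Fin N => X ((i : ℕ) + 1) ω) inferInstance

/-- The σ-algebra generated by `X_N, X_{N+1}, …`. -/
abbrev future {Ω : Type*} (X : ℕ → Ω → ℝ) (N : ℕ) : MeasurableSpace Ω :=
  MeasurableSpace.comap (fun ω => fun i : ℕ => X (N + i) ω) inferInstance

theorem measurable_past {Ω : Type*} (X : ℕ → Ω → ℝ) {i N : ℕ} (h1 : 1 ≤ i) (hN : i ≤ N) :
    Measurable[past X N] (X i) := by
  have h : X i = (fun x : Fin N → ℝ => x ⟨i - 1, by omega⟩) ∘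
      (fun ω => fun i : Fin N => X ((i : ℕ) + 1) ω) := by
    ext ω; simp [Nat.sub_add_cancel h1]
  rw [h]
  exact (measurable_pi_apply _).comp (comap_measurable _)

theorem measurable_future {Ω : Type*} (X : ℕ → Ω → ℝ) {i N : ℕ} (hN : N ≤ i) :
    Measurable[future X N] (X i) := by
  have h : X i = (fun x : ℕ → ℝ => x (i - N)) ∘ (fun ω => fun i : ℕ => X (N + i) ω) := by
    ext ω; simp [Nat.add_sub_cancel' hN]
  rw [h]
  exact (measurable_pi_apply _).comp (comap_measurable _)

theorem past_mono {Ω : Type*} (X : ℕ → Ω → ℝ) : Monotone (past X) := by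
  intro N N' h
  have : Measurable[past X N'] (fun ω => fun i : Fin N => X ((i : ℕ) + 1) ω) :=
    @measurable_pi_lambda _ _ _ (past X N') _ _
      fun i => measurable_past X (by omega) (by omega)
  exact measurable_iff_comap_le.1 this

theorem past_le {X : ℕ → Ω → ℝ} (hX : ∀ i, Measurable (X i)) (N : ℕ) :
    past X N ≤ MeasureSpace.toMeasurableSpace :=
  (measurable_pi_lambda _ fun _ => hX _).comap_le

theorem future_le {X : ℕ → Ω → ℝ} (hX : ∀ i, Measurable (X i)) (N : ℕ) :
    future X N ≤ MeasureSpace.toMeasurableSpace :=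
  (measurable_pi_lambda _ fun _ => hX _).comap_le

theorem abs_measureReal_inter_sub_le_betaMix [IsProbabilityMeasure (ℙ : Measure Ω)]
    {X : ℕ → Ω → ℝ} (hX : ∀ i, Measurable (X i)) (N lag : ℕ) {A B : Set Ω}
    (hA : MeasurableSet[past X N] A) (hB : MeasurableSet[future X (N + lag + 1)] B) :
    |(ℙ : Measure Ω).real (A ∩ B) - (ℙ : Measure Ω).real A * (ℙ : Measure Ω).real B|
      ≤ betaMix X lag := by
  have hm1 : ∀ m : ℕ, Measurable fun ω => fun i : Fin m => X ((i : ℕ) + 1) ω :=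
    fun m => measurable_pi_lambda _ fun _ => hX _
  have hm2 : ∀ m : ℕ, Measurable fun ω => fun i : ℕ => X (m + i) ω :=
    fun m => measurable_pi_lambda _ fun _ => hX _
  have hp : ∀ m, IsProbabilityMeasure (Measure.map (fun ω => fun i : Fin m => X ((i : ℕ) + 1) ω)
    (ℙ : Measure Ω)) := fun m => Measure.isProbabilityMeasure_map (hm1 m).aemeasurable
  have hf : ∀ m, IsProbabilityMeasure (Measure.map (fun ω => fun i : ℕ => X (m + i) ω)
    (ℙ : Measure Ω)) := fun m => Measure.isProbabilityMeasure_map (hm2 m).aemeasurable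
  have hj : ∀ m, IsProbabilityMeasure (Measure.map
        (fun ω => ((fun i : Fin m => X ((i : ℕ) + 1) ω, fun i : ℕ => X (m + lag + 1 + i) ω)))
        (ℙ : Measure Ω)) := fun m =>
    Measure.isProbabilityMeasure_map ((hm1 m).prodMk (hm2 _)).aemeasurable
  have hbd : ∀ {x y : ℝ}, 0 ≤ x → x ≤ 1 → 0 ≤ y → y ≤ 1 → |x - y| ≤ 1 := fun h1 h2 h3 h4 =>
    abs_le.2 ⟨by linarith, by linarith⟩
  have hle : ∀ (m : ℕ) (S : Subtype (MeasurableSet : Set ((Fin m → ℝ) × (ℕ → ℝ)) → Prop)),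
      |((Measure.map
        (fun ω => ((fun i : Fin m => X ((i : ℕ) + 1) ω, fun i : ℕ => X (m + lag + 1 + i) ω)))
        (ℙ : Measure Ω)) S.1).toReal
      - (((Measure.map (fun ω => fun i : Fin m => X ((i : ℕ) + 1) ω) (ℙ : Measure Ω)).prod
          (Measure.map (fun ω => fun i : ℕ => X (m + lag + 1 + i) ω) (ℙ : Measure Ω))) S.1).toReal|
        ≤ 1 := fun m S =>
    hbd measureReal_nonneg measureReal_le_one measureReal_nonneg measureReal_le_one
  have hne : ∀ m : ℕ, Nonempty (Subtype (MeasurableSet : Set ((Fin m → ℝ) × (ℕ → ℝ)) → Prop)) :=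
    fun m => ⟨⟨∅, MeasurableSet.empty⟩⟩
  obtain ⟨A', hA', rfl⟩ := hA
  obtain ⟨B', hB', rfl⟩ := hB
  have hS : MeasurableSet (A' ×ˢ B') := hA'.prod hB'
  unfold betaMix
  refine le_trans ?_ (le_ciSup (f := fun m : ℕ => ⨆ S : Subtype (MeasurableSet :
    Set ((Fin m → ℝ) × (ℕ → ℝ)) → Prop), _) ⟨1, ?_⟩ N)
  · refine le_trans (le_of_eq ?_) (le_ciSup ⟨1, ?_⟩ ⟨A' ×ˢ B', hS⟩)
    · rw [Measure.map_apply ((hm1 N).prodMk (hm2 _)) hS, Measure.prod_prod,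
        Measure.map_apply (hm1 N) hA', Measure.map_apply (hm2 _) hB', ENNReal.toReal_mul]
      rfl
    · rintro _ ⟨S, rfl⟩
      exact hle N S
  · rintro _ ⟨m, rfl⟩
    exact ciSup_le (hle m)

theorem integral_comp_eq_of_isStationary {X : ℕ → Ω → ℝ} (hX : ∀ i, Measurable (X i))
    (hstat : IsStationary X) {h : ℝ → ℝ} (hh : Measurable h) {i : ℕ} (hi : 1 ≤ i) :
    ∫ ω, h (X i ω) = ∫ ω, h (X 1 ω) := by
  have hm : ∀ j : ℕ, Measurable fun ω => fun i : ℕ => X (i + j) ω :=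
    fun j => measurable_pi_lambda _ fun _ => hX _
  have hev : Measurable fun x : ℕ → ℝ => h (x 1) := hh.comp (measurable_pi_apply 1)
  have h1 := integral_map (μ := (ℙ : Measure Ω)) (hm (i - 1)).aemeasurable
    (f := fun x : ℕ → ℝ => h (x 1)) hev.aestronglyMeasurable
  have h2 := integral_map (μ := (ℙ : Measure Ω)) (hm 0).aemeasurable
    (f := fun x : ℕ → ℝ => h (x 1)) hev.aestronglyMeasurable
  rw [hstat (i - 1)] at h1
  simp only [add_zero] at h2
  rw [h1] at h2
  simpa [Nat.add_sub_cancel' hi] using h2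

/-- Maximal inequality for sums over the blocks `(c + (2p+1)r, c + (2p+2)r]`. -/
theorem measureReal_exists_le_abs_blockSum [IsProbabilityMeasure (ℙ : Measure Ω)]
    {X : ℕ → Ω → ℝ} (hX : ∀ i, Measurable (X i)) (hstat : IsStationary X)
    {h : ℝ → ℝ} (hh : Measurable h) {C : ℝ} (hC : ∀ x, |h x| ≤ C) (c r m : ℕ)
    {ε : ℝ} (hε : 0 < ε) :
    (ℙ : Measure Ω).real {ω | ∃ P ≤ m, 2 * ε ≤ |∑ p ∈ Finset.range P,
        ∑ i ∈ Finset.Ioc (c + 2 * p * r + r) (c + 2 * p * r + 2 * r),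
          (h (X i ω) - ∫ ω', h (X 1 ω'))|}
      ≤ m * (4 * (r * (2 * C)) * (r * (2 * ∫ ω, |h (X 1 ω)|))) / ε ^ 2
        + m * (4 * (r * (2 * C)) * betaMix X r) / ε := by
  have hC0 : 0 ≤ C := (abs_nonneg _).trans (hC 0)
  set e := ∫ ω', h (X 1 ω') with he
  have hint : ∀ i, Integrable (fun ω => h (X i ω)) (ℙ : Measure Ω) := fun i =>
    Integrable.of_bound (hh.comp (hX i)).aestronglyMeasurable C (ae_of_all _ fun ω => hC _)
  have heC : |e| ≤ C := by
    have := norm_integral_le_of_norm_le_const (μ := (ℙ : Measure Ω)) (f := fun ω => h (X 1 ω))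
      (ae_of_all _ fun ω => hC _)
    simpa using this
  have heabs : |e| ≤ ∫ ω, |h (X 1 ω)| := abs_integral_le_integral_abs
  set W : ℕ → Ω → ℝ := fun p ω =>
    ∑ i ∈ Finset.Ioc (c + 2 * p * r + r) (c + 2 * p * r + 2 * r), (h (X i ω) - e) with hW
  have hcard : ∀ p, (Finset.Ioc (c + 2 * p * r + r) (c + 2 * p * r + 2 * r)).card = r := by
    intro p; rw [Nat.card_Ioc]; omega
  let 𝒢 : Filtration ℕ (MeasureSpace.toMeasurableSpace (α := Ω)) :=
    { seq := fun p => past X (c + 2 * p * r)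
      mono' := fun p q hpq => past_mono X (by gcongr)
      le' := fun p => past_le hX _ }
  have hWM : ∀ p ω, |W p ω| ≤ r * (2 * C) := by
    intro p ω
    calc |W p ω| ≤ ∑ i ∈ Finset.Ioc (c + 2 * p * r + r) (c + 2 * p * r + 2 * r),
          |h (X i ω) - e| := Finset.abs_sum_le_sum_abs _ _
      _ ≤ ∑ i ∈ Finset.Ioc (c + 2 * p * r + r) (c + 2 * p * r + 2 * r), 2 * C :=
          Finset.sum_le_sum fun i _ => (abs_sub _ _).trans (by linarith [hC (X i ω)])
      _ = r * (2 * C) := by rw [Finset.sum_const, hcard, nsmul_eq_mul]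
  have hWmeas : ∀ p, Measurable[future X (c + 2 * p * r + r + 1)] (W p) := by
    intro p
    refine Finset.measurable_fun_sum _ fun i hi => ?_
    have hXi := measurable_future X (Nat.succ_le_of_lt (Finset.mem_Ioc.1 hi).1)
    exact (hh.comp hXi).sub_const e
  have hW0 : ∀ p, ∫ ω, W p ω = 0 := by
    intro p
    have hsub : ∀ i, Integrable (fun ω => h (X i ω) - e) (ℙ : Measure Ω) := fun i =>
      (hint i).sub (integrable_const e)
    rw [integral_finsetSum _ fun i _ => hsub i]
    refine Finset.sum_eq_zero fun i hi => ?_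
    have hi1 : 1 ≤ i := by have := (Finset.mem_Ioc.1 hi).1; omega
    rw [integral_sub (hint i) (integrable_const e),
      integral_comp_eq_of_isStationary hX hstat hh hi1]
    simp [he]
  refine measureReal_exists_le_abs_sum_adapted 𝒢 W ?_ _ (by positivity) hWM _ ?_ _ ?_ m hε
  · intro p
    refine Measurable.stronglyMeasurable ?_
    refine Finset.measurable_fun_sum _ fun i hi => ?_
    have hXi : Measurable[𝒢 (p + 1)] (X i) := by
      have h1 := Finset.mem_Ioc.1 hi
      refine measurable_past X (by omega) (h1.2.trans (le_of_eq ?_))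
      ring
    exact (hh.comp hXi).sub_const e
  · intro p
    calc ∫ ω, |W p ω| ≤ ∫ ω, ∑ i ∈ Finset.Ioc (c + 2 * p * r + r) (c + 2 * p * r + 2 * r),
          |h (X i ω) - e| := by
          refine integral_mono_of_nonneg (ae_of_all _ fun ω => abs_nonneg _)
            (integrable_finsetSum _ fun i _ => ((hint i).sub (integrable_const e)).abs)
            (ae_of_all _ fun ω => Finset.abs_sum_le_sum_abs _ _)
      _ = ∑ i ∈ Finset.Ioc (c + 2 * p * r + r) (c + 2 * p * r + 2 * r),
          ∫ ω, |h (X i ω) - e| :=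
          integral_finsetSum _ fun i _ => ((hint i).sub (integrable_const e)).abs
      _ ≤ ∑ i ∈ Finset.Ioc (c + 2 * p * r + r) (c + 2 * p * r + 2 * r),
          2 * ∫ ω, |h (X 1 ω)| := by
          refine Finset.sum_le_sum fun i hi => ?_
          have hi1 : 1 ≤ i := by have := (Finset.mem_Ioc.1 hi).1; omega
          calc ∫ ω, |h (X i ω) - e| ≤ ∫ ω, (|h (X i ω)| + |e|) :=
                integral_mono ((hint i).sub (integrable_const e)).abs
                  ((hint i).abs.add (integrable_const _)) fun ω => abs_sub _ _
            _ = (∫ ω, |h (X 1 ω)|) + |e| := by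
                rw [integral_add (hint i).abs (integrable_const _),
                  integral_comp_eq_of_isStationary hX hstat hh.abs hi1]
                simp
            _ ≤ _ := by linarith
      _ = _ := by rw [Finset.sum_const, hcard, nsmul_eq_mul]
  · intro p
    exact integral_abs_condExp_le_of_forall_abs_sub_le (past_le hX _)
      (future_le hX (c + 2 * p * r + r + 1)) (hWmeas p) (by positivity) (hWM p) (hW0 p)
      fun A B hA hB => abs_measureReal_inter_sub_le_betaMix hX _ _ hA hB

theorem sum_Ioc_eq_sum_blocks (Y : ℕ → ℝ) (r P : ℕ) :
    ∑ i ∈ Finset.Ioc 0 (r + 2 * P * r), Y i = ∑ i ∈ Finset.Ioc 0 r, Y i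
      + ∑ p ∈ Finset.range P, ∑ i ∈ Finset.Ioc (0 + 2 * p * r + r) (0 + 2 * p * r + 2 * r), Y i
      + ∑ p ∈ Finset.range P, ∑ i ∈ Finset.Ioc (r + 2 * p * r + r) (r + 2 * p * r + 2 * r), Y i := by
  induction P with
  | zero => simp
  | succ P ih =>
    have h1 : r + 2 * (P + 1) * r = r + 2 * P * r + 2 * r := by ring
    have h2 := Finset.sum_Ioc_consecutive Y (Nat.zero_le (r + 2 * P * r))
      (show r + 2 * P * r ≤ r + 2 * P * r + r by omega)
    have h3 := Finset.sum_Ioc_consecutive Y (Nat.zero_le (r + 2 * P * r + r))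
      (show r + 2 * P * r + r ≤ r + 2 * P * r + 2 * r by omega)
    have h4 : 0 + 2 * P * r + r = r + 2 * P * r := by ring
    have h5 : 0 + 2 * P * r + 2 * r = r + 2 * P * r + r := by ring
    rw [Finset.sum_range_succ, Finset.sum_range_succ, h1, ← h3, ← h2, ih, h4, h5]
    ring

theorem abs_sum_Ioc_sub_le {Y : ℕ → ℝ} {C : ℝ} (hY : ∀ i, |Y i| ≤ C) {a b r : ℕ}
    (hab : a ≤ b + r) (hba : b ≤ a + r) :
    |∑ i ∈ Finset.Ioc 0 a, Y i - ∑ i ∈ Finset.Ioc 0 b, Y i| ≤ r * C := by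
  have hC0 : 0 ≤ C := (abs_nonneg _).trans (hY 0)
  wlog h : a ≤ b generalizing a b
  · rw [abs_sub_comm]; exact this hba hab (not_le.1 h).le
  have h2 := Finset.sum_Ioc_consecutive Y (Nat.zero_le a) h
  rw [abs_sub_comm, ← h2, add_sub_cancel_left]
  calc |∑ i ∈ Finset.Ioc a b, Y i| ≤ ∑ i ∈ Finset.Ioc a b, |Y i| := Finset.abs_sum_le_sum_abs _ _
    _ ≤ ∑ i ∈ Finset.Ioc a b, C := Finset.sum_le_sum fun i _ => hY i
    _ = ((b - a : ℕ) : ℝ) * C := by simp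
    _ ≤ r * C := by gcongr; omega

/-- Maximal inequality for partial sums of bounded functionals of a stationary `β`-mixing
sequence. -/
theorem measureReal_exists_le_abs_sum_le [IsProbabilityMeasure (ℙ : Measure Ω)]
    {X : ℕ → Ω → ℝ} (hX : ∀ i, Measurable (X i)) (hstat : IsStationary X)
    {h : ℝ → ℝ} (hh : Measurable h) {C : ℝ} (hC : ∀ x, |h x| ≤ C) {r : ℕ} (hr : 0 < r) (n : ℕ)
    {ε : ℝ} (hε : 0 < ε) (hrε : 2 * (r * (2 * C)) < ε) :
    (ℙ : Measure Ω).real {ω | ∃ j ≤ n, 5 * ε ≤ |∑ i ∈ Finset.Icc 1 j,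
          (h (X i ω) - ∫ ω', h (X 1 ω'))|}
      ≤ 2 * (16 * C * (n * r * ∫ ω, |h (X 1 ω)|) / ε ^ 2 + 8 * C * (n * betaMix X r) / ε) := by
  have hC0 : 0 ≤ C := (abs_nonneg _).trans (hC 0)
  set e := ∫ ω', h (X 1 ω') with he
  have heC : |e| ≤ C := by
    have := norm_integral_le_of_norm_le_const (μ := (ℙ : Measure Ω)) (f := fun ω => h (X 1 ω))
      (ae_of_all _ fun ω => hC _)
    simpa using this
  set m := n / (2 * r) with hm
  have hβ0 : 0 ≤ betaMix X r := by
    have := abs_measureReal_inter_sub_le_betaMix hX 0 r (A := ∅) (B := ∅)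
      (@MeasurableSet.empty _ (past X 0)) (@MeasurableSet.empty _ (future X (0 + r + 1)))
    exact (abs_nonneg _).trans this
  have hδ0 : 0 ≤ ∫ ω, |h (X 1 ω)| := integral_nonneg fun ω => abs_nonneg _
  have hmr : (m : ℝ) * r ≤ n := by
    have h1 : m * r ≤ n := by
      have := Nat.div_mul_le_self n (2 * r)
      calc m * r ≤ m * (2 * r) := by gcongr; omega
        _ ≤ n := this
    exact_mod_cast h1
  have hb : ∀ c : ℕ, (ℙ : Measure Ω).real {ω | ∃ P ≤ m, 2 * ε ≤ |∑ p ∈ Finset.range P,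
        ∑ i ∈ Finset.Ioc (c + 2 * p * r + r) (c + 2 * p * r + 2 * r), (h (X i ω) - e)|}
      ≤ 16 * C * (n * r * ∫ ω, |h (X 1 ω)|) / ε ^ 2 + 8 * C * (n * betaMix X r) / ε := by
    intro c
    refine (measureReal_exists_le_abs_blockSum hX hstat hh hC c r m hε).trans ?_
    have e1 : (m : ℝ) * (4 * (r * (2 * C)) * (r * (2 * ∫ ω, |h (X 1 ω)|)))
        = 16 * C * ((m * r) * r * ∫ ω, |h (X 1 ω)|) := by ring
    have e2 : (m : ℝ) * (4 * (r * (2 * C)) * betaMix X r) = 8 * C * ((m * r) * betaMix X r) := by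
      ring
    rw [e1, e2]
    gcongr
  rw [two_mul]
  refine le_trans (measureReal_mono ?_) ((measureReal_union_le _ _).trans
    (add_le_add (hb 0) (hb r)))
  rintro ω ⟨j, hj, hlt⟩
  by_contra hcon
  simp only [mem_union, mem_ofPred_eq, not_or, not_exists, not_and, not_le] at hcon
  set Y : ℕ → ℝ := fun i => h (X i ω) - e with hY
  have hYC : ∀ i, |Y i| ≤ 2 * C := fun i =>
    (abs_sub _ _).trans (by linarith [hC (X i ω)])
  set P := j / (2 * r) with hP
  have hPm : P ≤ m := Nat.div_le_div_right hj
  have hPj : 2 * P * r + j % (2 * r) = j := by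
    calc 2 * P * r + j % (2 * r) = 2 * r * P + j % (2 * r) := by ring
      _ = j := Nat.div_add_mod j (2 * r)
  have hmod : j % (2 * r) < 2 * r := Nat.mod_lt _ (by omega)
  have h1 := abs_sum_Ioc_sub_le hYC (a := j) (b := r + 2 * P * r) (r := r) (by omega) (by omega)
  have h2 := abs_sum_Ioc_sub_le hYC (a := r) (b := 0) (r := r) (by omega) (by omega)
  rw [sum_Ioc_eq_sum_blocks] at h1
  have h3 := hcon.1 P hPm
  have h4 := hcon.2 P hPm
  have h5 : Finset.Icc 1 j = Finset.Ioc 0 j := rfl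
  rw [h5] at hlt
  simp only [Finset.Ioc_self, Finset.sum_empty, sub_zero] at h2
  change 5 * ε ≤ |∑ i ∈ Finset.Ioc 0 j, Y i| at hlt
  rw [abs_lt] at h3 h4
  rw [abs_le] at h1 h2
  have : |∑ i ∈ Finset.Ioc 0 j, Y i| < 5 * ε := abs_lt.2 ⟨by linarith, by linarith⟩
  linarith

/-- If two sequences of measurable sets eventually contain each point of `[0, 1]`, then
eventually they have a common point up to a vanishing shift. -/
theorem eventually_exists_mem_and_sub_mem {A B : ℕ → Set ℝ} (hA : ∀ n, MeasurableSet (A n))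
    (hB : ∀ n, MeasurableSet (B n)) (hA1 : ∀ s ∈ Icc (0 : ℝ) 1, ∀ᶠ n in atTop, s ∈ A n)
    (hB1 : ∀ s ∈ Icc (0 : ℝ) 1, ∀ᶠ n in atTop, s ∈ B n) {v : ℕ → ℝ}
    (hv : Tendsto v atTop (nhds 0)) : ∀ᶠ n in atTop, ∃ s, s ∈ A n ∧ s - v n ∈ B n := by
  have key : ∀ {A : ℕ → Set ℝ}, (∀ n, MeasurableSet (A n)) →
      (∀ s ∈ Icc (0 : ℝ) 1, ∀ᶠ n in atTop, s ∈ A n) →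
      ∀ᶠ n in atTop, volume (Icc (0 : ℝ) 1 \ A n) < ENNReal.ofReal (1 / 4) := by
    intro A hA hA1
    have h := tendsto_measure_of_tendsto_indicator (μ := volume) (A := (∅ : Set ℝ)) atTop
      (As := fun n => Icc (0 : ℝ) 1 \ A n) (fun n => measurableSet_Icc.diff (hA n))
      (B := Icc 0 1) measurableSet_Icc (by simp) (Eventually.of_forall fun n => sdiff_subset) ?_
    · rw [measure_empty] at h
      exact h.eventually_lt_const (by simp)
    · intro s
      by_cases hs : s ∈ Icc (0 : ℝ) 1
      · filter_upwards [hA1 s hs] with n hn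
        simp [hn]
      · exact Eventually.of_forall fun n => by simp [hs]
  have hv4 : ∀ᶠ n in atTop, |v n| < 1 / 4 := by
    have := hv.abs
    rw [abs_zero] at this
    exact this.eventually_lt_const (by norm_num)
  filter_upwards [key hA hA1, key hB hB1, hv4] with n h1 h2 h3
  by_contra! hcon
  have hsub : Icc (1 / 4 : ℝ) (3 / 4) ⊆ (Icc (0 : ℝ) 1 \ A n) ∪
      (fun s => s + -v n) ⁻¹' (Icc (0 : ℝ) 1 \ B n) := by
    intro s hs
    rw [abs_lt] at h3
    by_cases hsA : s ∈ A n
    · right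
      exact ⟨⟨by linarith [hs.1, h3.2], by linarith [hs.2, h3.1]⟩, hcon s hsA⟩
    · left
      exact ⟨⟨by linarith [hs.1], by linarith [hs.2]⟩, hsA⟩
  have h4 := (measure_mono (μ := (volume : Measure ℝ)) hsub).trans (measure_union_le _ _)
  rw [measure_preimage_add_right, Real.volume_Icc] at h4
  have h5 := h4.trans_lt (ENNReal.add_lt_add h1 h2)
  rw [← ENNReal.ofReal_add (by norm_num) (by norm_num)] at h5
  norm_num at h5

theorem abs_kappaFun_exp_le {K γ : ℝ} (hγ : γ ≤ 0) {s : ℝ} (hs : s ∈ Icc (0 : ℝ) 1) :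
    |kappaFun K γ (Real.exp s)| ≤ 2 * |K| := by
  have h1 : (1 : ℝ) ≤ Real.exp s := Real.one_le_exp hs.1
  have h3 : Real.exp s ≤ 3 :=
    (Real.exp_le_exp.2 hs.2).trans (Real.exp_one_lt_d9.le.trans (by norm_num))
  have h2 := intervalIntegral.norm_integral_le_of_norm_le_const (a := 1) (b := Real.exp s)
    (C := 1) (f := fun t : ℝ => t ^ (γ - 1)) (fun t ht => by
      rw [uIoc_of_le h1] at ht
      rw [Real.norm_of_nonneg (Real.rpow_nonneg (by linarith [ht.1]) _)]
      exact Real.rpow_le_one_of_one_le_of_nonpos ht.1.le (by linarith))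
  rw [Real.norm_eq_abs, abs_of_nonneg (sub_nonneg.2 h1)] at h2
  rw [kappaFun, abs_mul]
  nlinarith [abs_nonneg K]

/-- Second-order regular variation bounds the relative increments of `l` along shifts of a
sequence by factors tending to one. -/
theorem SecondOrderRV.eventually_abs_div_sub_one_le {l g : ℝ → ℝ} {K γ : ℝ}
    (h2 : SecondOrderRV l g K γ) (hl : Measurable l) (hlpos : ∀ x, 0 < x → 0 < l x)
    {x v : ℕ → ℝ} (hx : Tendsto x atTop atTop) (hv : Tendsto v atTop (nhds 0))
    (hg0 : Tendsto (fun n => g (x n)) atTop (nhds 0)) :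
    ∃ C, 0 ≤ C ∧ ∀ᶠ n in atTop, |l (Real.exp (v n) * x n) / l (x n) - 1| ≤ C * g (x n) := by
  obtain ⟨hγ, hgpos, ⟨hgm, hgrv⟩, hl2⟩ := h2
  set M := 2 * |K| + 1 with hM
  have hM0 : 0 < M := by positivity
  set c := Real.exp γ / 2 with hc
  have hc0 : 0 < c := by positivity
  set G : ℝ → Set ℝ := fun y => {s | |(l (Real.exp s * y) / l y - 1) / g y| ≤ M ∧
    g (Real.exp s * y) / g y ≤ 2 ∧ c ≤ g (Real.exp s * y) / g y} with hG
  have hGm : ∀ y, MeasurableSet (G y) := by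
    intro y
    have he : Measurable fun s : ℝ => Real.exp s * y := Real.measurable_exp.mul_const y
    have hle := hl.comp he
    have hge := hgm.comp he
    exact (measurableSet_le (((hle.div_const _).sub_const _).div_const _).abs measurable_const).inter
      ((measurableSet_le (hge.div_const _) measurable_const).inter
        (measurableSet_le measurable_const (hge.div_const _)))
  have hGe : ∀ {y : ℕ → ℝ}, Tendsto y atTop atTop → ∀ s ∈ Icc (0 : ℝ) 1,
      ∀ᶠ n in atTop, s ∈ G (y n) := by
    intro y hy s hs
    have h1 := ((hl2 _ (Real.exp_pos s)).comp hy).abs.eventually_le_const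
      (u := M) (by linarith [abs_kappaFun_exp_le (K := K) hγ hs])
    have hexp : Real.exp s ^ γ = Real.exp (s * γ) := (Real.exp_mul s γ).symm
    have h2 := ((hgrv _ (Real.exp_pos s)).comp hy).eventually_le_const (u := 2) (by
      rw [hexp]
      have : Real.exp (s * γ) ≤ 1 := Real.exp_le_one_iff.2 (by nlinarith [hs.1])
      linarith)
    have h3 := ((hgrv _ (Real.exp_pos s)).comp hy).eventually_const_le (u := c) (by
      rw [hexp]
      have : Real.exp γ ≤ Real.exp (s * γ) := Real.exp_le_exp.2 (by nlinarith [hs.2])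
      have := Real.exp_pos γ
      linarith)
    filter_upwards [h1, h2, h3] with n e1 e2 e3
    exact ⟨e1, e2, e3⟩
  set y : ℕ → ℝ := fun n => Real.exp (v n) * x n with hy
  have hexpv : Tendsto (fun n => Real.exp (v n)) atTop (nhds 1) := by
    have := (Real.continuous_exp.tendsto 0).comp hv
    rwa [Real.exp_zero] at this
  have hytop : Tendsto y atTop atTop := hexpv.pos_mul_atTop one_pos hx
  refine ⟨2 * (M * (1 + 2 / c)), by positivity, ?_⟩
  have hsmall : ∀ᶠ n in atTop, M * (2 / c) * g (x n) ≤ 1 / 2 := by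
    have := hg0.const_mul (M * (2 / c))
    rw [mul_zero] at this
    exact this.eventually_le_const (by norm_num)
  filter_upwards [eventually_exists_mem_and_sub_mem (fun n => hGm (x n)) (fun n => hGm (y n))
    (hGe hx) (hGe hytop) hv, hx.eventually_gt_atTop 0, hsmall] with n ⟨s, hs1, hs2⟩ hx0 hsm
  have hy0 : 0 < y n := mul_pos (Real.exp_pos _) hx0
  have hz : Real.exp (s - v n) * y n = Real.exp s * x n := by
    simp only [hy]
    rw [← mul_assoc, ← Real.exp_add, sub_add_cancel]
  simp only [hG, mem_ofPred_eq, hz] at hs1 hs2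
  obtain ⟨a1, a2, -⟩ := hs1
  obtain ⟨b1, -, b3⟩ := hs2
  set z := Real.exp s * x n
  have hgx := hgpos (x n)
  have hgy := hgpos (y n)
  rw [abs_div, abs_of_pos hgx, div_le_iff₀ hgx] at a1
  rw [abs_div, abs_of_pos hgy, div_le_iff₀ hgy] at b1
  rw [div_le_iff₀ hgx] at a2
  rw [le_div_iff₀ hgy] at b3
  have hgyx : g (y n) ≤ 2 / c * g (x n) := by
    rw [div_mul_eq_mul_div, le_div_iff₀ hc0]; linarith
  have hMgy : M * g (y n) ≤ M * (2 / c) * g (x n) := by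
    rw [mul_assoc]; gcongr
  have hlx := hlpos _ hx0
  have hly := hlpos _ hy0
  set p := l z / l (x n) with hp
  set q := l z / l (y n) with hq
  have hq0 : 1 / 2 ≤ q := by
    have := (abs_le.1 b1).1
    linarith
  have hlz : l z ≠ 0 := by
    intro h
    rw [hq, h, zero_div] at hq0
    norm_num at hq0
  have hratio : l (y n) / l (x n) = p / q := by
    rw [hp, hq]; field_simp
  change |l (y n) / l (x n) - 1| ≤ _
  rw [hratio, div_sub_one (by linarith), abs_div, abs_of_pos (show 0 < q by linarith),
    div_le_iff₀ (by linarith)]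
  have hpq : |p - q| ≤ M * (1 + 2 / c) * g (x n) := by
    calc |p - q| = |(p - 1) - (q - 1)| := by ring_nf
      _ ≤ |p - 1| + |q - 1| := abs_sub _ _
      _ ≤ M * g (x n) + M * g (y n) := add_le_add a1 b1
      _ ≤ M * g (x n) + M * (2 / c) * g (x n) := by linarith
      _ = _ := by ring
  have : 0 ≤ M * (1 + 2 / c) * g (x n) := by positivity
  nlinarith

theorem tailDF_antitone (μ : Measure ℝ) [IsProbabilityMeasure μ] : Antitone (tailDF μ) :=
  fun _ _ h => measureReal_mono (Ioi_subset_Ioi h)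

theorem tailDF_eq_one_sub_df (μ : Measure ℝ) [IsProbabilityMeasure μ] (x : ℝ) :
    tailDF μ x = 1 - df μ x := by
  have := probReal_compl_eq_one_sub (μ := μ) (measurableSet_Iic (a := x))
  rwa [compl_Iic] at this

theorem ParetoTail.tailDF_pos {μ : Measure ℝ} [IsProbabilityMeasure μ] {α : ℝ} {l : ℝ → ℝ}
    (h : ParetoTail μ α l) (x : ℝ) : 0 < tailDF μ x := by
  by_contra hx
  have hx0 : tailDF μ x = 0 := le_antisymm (not_lt.1 hx) measureReal_nonneg
  have hl0 : ∀ᶠ y in atTop, l (1 * y) / l y = 0 := by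
    filter_upwards [eventually_ge_atTop x, eventually_gt_atTop 0] with y hxy hy
    have h1 : tailDF μ y = 0 := le_antisymm (hx0 ▸ tailDF_antitone μ hxy) measureReal_nonneg
    rw [h.2 y hy] at h1
    have h2 : l y = 0 := (mul_eq_zero.1 h1).resolve_left (Real.rpow_pos_of_pos hy _).ne'
    simp [h2]
  have h3 := (h.1.2 1 one_pos).congr' hl0
  exact zero_ne_one (tendsto_nhds_unique tendsto_const_nhds h3)

theorem ParetoTail.slowlyVarying_pos {μ : Measure ℝ} [IsProbabilityMeasure μ] {α : ℝ} {l : ℝ → ℝ}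
    (h : ParetoTail μ α l) {x : ℝ} (hx : 0 < x) : 0 < l x := by
  have h1 := h.tailDF_pos x
  rw [h.2 x hx] at h1
  exact (pos_iff_pos_of_mul_pos h1).1 (Real.rpow_pos_of_pos hx _)

theorem tailDF_quantileB_le (μ : Measure ℝ) [IsProbabilityMeasure μ] {x : ℝ} (hx : 1 < x) :
    tailDF μ (quantileB μ x) ≤ x⁻¹ := by
  have hxi : 0 < 1 - x⁻¹ := sub_pos.2 (inv_lt_one_of_one_lt₀ hx)
  have hxi' : 1 - x⁻¹ < 1 := sub_lt_self _ (inv_pos.2 (one_pos.trans hx))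
  have hdf : ∀ y, df μ y = cdf μ y := fun y => (cdf_eq_real μ y).symm
  set S := {y : ℝ | 1 - x⁻¹ ≤ df μ y} with hS
  have hne : S.Nonempty := by
    obtain ⟨y, hy⟩ := ((tendsto_cdf_atTop μ).eventually_const_le hxi').exists
    exact ⟨y, by rw [hS, mem_ofPred_eq, hdf]; exact hy⟩
  have hbdd : BddBelow S := by
    obtain ⟨y, hy⟩ := ((tendsto_cdf_atBot μ).eventually_lt_const hxi).exists
    refine ⟨y, fun z hz => le_of_not_gt fun hzy => ?_⟩
    rw [hS, mem_ofPred_eq, hdf] at hz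
    exact absurd (hz.trans (monotone_cdf μ hzy.le)) (not_le.2 hy)
  rw [tailDF_eq_one_sub_df, hdf]
  have h1 : Tendsto (cdf μ) (nhdsWithin (quantileB μ x) (Ioi (quantileB μ x)))
      (nhds (cdf μ (quantileB μ x))) :=
    ((cdf μ).right_continuous _).mono_left (nhdsWithin_mono _ Ioi_subset_Ici_self)
  have h2 : 1 - x⁻¹ ≤ cdf μ (quantileB μ x) := by
    refine ge_of_tendsto h1 (eventually_mem_nhdsWithin.mono fun y hy => ?_)
    obtain ⟨z, hz, hzy⟩ := exists_lt_of_csInf_lt hne hy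
    rw [hS, mem_ofPred_eq, hdf] at hz
    exact hz.trans (monotone_cdf μ hzy.le)
  linarith

theorem tendsto_quantileB_atTop (μ : Measure ℝ) [IsProbabilityMeasure μ]
    (hpos : ∀ x, 0 < tailDF μ x) : Tendsto (quantileB μ) atTop atTop := by
  refine tendsto_atTop.2 fun M => ?_
  have h1 : ∀ᶠ x : ℝ in atTop, x⁻¹ < tailDF μ M :=
    tendsto_inv_atTop_zero.eventually_lt_const (hpos M)
  filter_upwards [h1, eventually_gt_atTop 0] with x hx hx0
  have hne : {y : ℝ | 1 - x⁻¹ ≤ df μ y}.Nonempty := by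
    obtain ⟨y, hy⟩ := ((tendsto_cdf_atTop μ).eventually_const_le
      (sub_lt_self 1 (inv_pos.2 hx0))).exists
    exact ⟨y, by rw [mem_ofPred_eq]; exact hy.trans (cdf_eq_real μ y).le⟩
  refine le_csInf hne fun y hy => le_of_not_gt fun hyM => ?_
  rw [mem_ofPred_eq] at hy
  have h2 := tailDF_antitone μ hyM.le
  rw [tailDF_eq_one_sub_df μ y] at h2
  linarith

theorem TailFraction.eventually_pos {k : ℕ → ℕ} (hk : TailFraction k) :
    ∀ᶠ n in atTop, 0 < k n := by
  filter_upwards [hk.1.eventually_gt_atTop 0] with n hn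
  exact_mod_cast hn

theorem TailFraction.tendsto_div_atTop {k : ℕ → ℕ} (hk : TailFraction k) :
    Tendsto (fun n : ℕ => (n : ℝ) / k n) atTop atTop := by
  have h1 : Tendsto (fun n : ℕ => (k n : ℝ) / n) atTop (nhdsWithin 0 (Ioi 0)) := by
    refine tendsto_nhdsWithin_iff.2 ⟨hk.2, ?_⟩
    filter_upwards [hk.eventually_pos, eventually_gt_atTop 0] with n h1 h2
    have h1' : (0 : ℝ) < k n := Nat.cast_pos.2 h1
    have h2' : (0 : ℝ) < n := Nat.cast_pos.2 h2
    exact div_pos h1' h2'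
  exact h1.inv_tendsto_nhdsGT_zero.congr fun n => by rw [Pi.inv_apply, inv_div]

theorem TailFraction.tendsto_sqrt_atTop {k : ℕ → ℕ} (hk : TailFraction k) :
    Tendsto (fun n : ℕ => Real.sqrt (k n)) atTop atTop :=
  Real.tendsto_sqrt_atTop.comp hk.1

/-- The tail at the shifted threshold `b(n/k) e^{-z/√k}` differs from the tail at `b(n/k)` by
`O(√k / n)`. -/
theorem exists_eventually_abs_tailDF_sub_le {μ : Measure ℝ} [IsProbabilityMeasure μ]
    {α : ℝ} (hα : 0 < α) {l : ℝ → ℝ} (hF : ParetoTail μ α l) {k : ℕ → ℕ} (hk : TailFraction k)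
    {g : ℝ → ℝ} {K γ A : ℝ} (hA2 : CondA2 l g K γ A (quantileB μ) k) (z : ℝ) :
    ∃ C, 0 ≤ C ∧ ∀ᶠ n : ℕ in atTop,
      |tailDF μ (Real.exp (-(z / Real.sqrt (k n))) * quantileB μ (n / k n))
        - tailDF μ (quantileB μ (n / k n))| ≤ C * (Real.sqrt (k n) / n) := by
  have hs := hk.tendsto_sqrt_atTop
  have hnk := hk.tendsto_div_atTop
  set x : ℕ → ℝ := fun n => quantileB μ (n / k n) with hxdef
  set v : ℕ → ℝ := fun n => -(z / Real.sqrt (k n)) with hvdef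
  have hx : Tendsto x atTop atTop := (tendsto_quantileB_atTop μ hF.tailDF_pos).comp hnk
  have hv : Tendsto v atTop (nhds 0) := by
    simpa using (hs.const_div_atTop z).neg
  have hg0 : Tendsto (fun n => g (x n)) atTop (nhds 0) := by
    have h1 := hA2.2.mul hs.inv_tendsto_atTop
    rw [mul_zero] at h1
    refine h1.congr' ?_
    filter_upwards [hs.eventually_gt_atTop 0] with n hn
    simp only [Pi.inv_apply]
    field_simp
    rfl
  obtain ⟨C, hC0, hC⟩ := hA2.1.eventually_abs_div_sub_one_le hF.1.1
    (fun x hx => hF.slowlyVarying_pos hx) hx hv hg0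
  have hgA : ∀ᶠ n in atTop, Real.sqrt (k n) * g (x n) ≤ |A| + 1 :=
    hA2.2.eventually_le_const (by linarith [le_abs_self A])
  have hαv : ∀ᶠ n in atTop, |α * v n| ≤ 1 := by
    have := (hv.const_mul α).abs
    rw [mul_zero, abs_zero] at this
    exact this.eventually_le_const one_pos
  refine ⟨2 * α * |z| + 3 * C * (|A| + 1), by positivity, ?_⟩
  filter_upwards [hC, hgA, hαv, hx.eventually_gt_atTop 0, hs.eventually_gt_atTop 0,
    hnk.eventually_gt_atTop 1, eventually_gt_atTop 0] with n h1 h2 h3 hx0 hs0 hnk1 hn0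
  change |tailDF μ (Real.exp (v n) * x n) - tailDF μ (x n)| ≤ _
  have hn0' : (0 : ℝ) < n := Nat.cast_pos.2 hn0
  have hsq : Real.sqrt (k n) * Real.sqrt (k n) = k n := Real.mul_self_sqrt (Nat.cast_nonneg _)
  have hlx := hF.slowlyVarying_pos hx0
  have ht0 : 0 ≤ tailDF μ (x n) := measureReal_nonneg
  have ht : tailDF μ (x n) ≤ k n / n := by
    simpa using tailDF_quantileB_le μ hnk1
  set ρ := l (Real.exp (v n) * x n) / l (x n) - 1 with hρ
  have hident : tailDF μ (Real.exp (v n) * x n) - tailDF μ (x n)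
      = (Real.exp (-(α * v n)) * (1 + ρ) - 1) * tailDF μ (x n) := by
    rw [hF.2 _ (mul_pos (Real.exp_pos _) hx0), hF.2 _ hx0,
      Real.mul_rpow (Real.exp_pos _).le hx0.le, ← Real.exp_mul, hρ]
    have : v n * -α = -(α * v n) := by ring
    rw [this]
    field_simp
    ring
  have hexp1 : |Real.exp (-(α * v n)) - 1| ≤ 2 * |α * v n| := by
    simpa using Real.abs_exp_sub_one_le (x := -(α * v n)) (by simpa using h3)
  have hexp3 : Real.exp (-(α * v n)) ≤ 3 := by
    have := (abs_le.1 hexp1).2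
    linarith
  have hvabs : |α * v n| = α * |z| / Real.sqrt (k n) := by
    rw [abs_mul, abs_of_pos hα, hvdef, abs_neg, abs_div, abs_of_pos hs0, mul_div_assoc]
  have hgle : g (x n) ≤ (|A| + 1) / Real.sqrt (k n) := by
    rw [le_div_iff₀ hs0]; linarith
  have hfac : |Real.exp (-(α * v n)) * (1 + ρ) - 1|
      ≤ (2 * α * |z| + 3 * C * (|A| + 1)) / Real.sqrt (k n) := by
    calc |Real.exp (-(α * v n)) * (1 + ρ) - 1|
        = |(Real.exp (-(α * v n)) - 1) + Real.exp (-(α * v n)) * ρ| := by ring_nf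
      _ ≤ |Real.exp (-(α * v n)) - 1| + |Real.exp (-(α * v n)) * ρ| := abs_add_le _ _
      _ ≤ 2 * |α * v n| + 3 * (C * g (x n)) := by
          rw [abs_mul, abs_of_pos (Real.exp_pos _)]
          gcongr
      _ ≤ 2 * (α * |z| / Real.sqrt (k n)) + 3 * (C * ((|A| + 1) / Real.sqrt (k n))) := by
          rw [hvabs]; gcongr
      _ = _ := by ring
  rw [hident, abs_mul, abs_of_nonneg ht0]
  calc _ ≤ (2 * α * |z| + 3 * C * (|A| + 1)) / Real.sqrt (k n) * (k n / n) := by gcongr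
    _ = (2 * α * |z| + 3 * C * (|A| + 1)) * (Real.sqrt (k n) / n) := by
        generalize Real.sqrt (k n) = s at hs0 hsq ⊢
        rw [← hsq]
        field_simp

/-- Partial sums of a bounded function of a `β`-mixing stationary sequence are uniformly
`o_P(√k)` as soon as the first absolute moment is `O(√k / n)`. -/
theorem tendsto_measureReal_exists_le_abs_sum {Ω : Type*} [MeasureSpace Ω]
    [IsProbabilityMeasure (ℙ : Measure Ω)] {X : ℕ → Ω → ℝ} (hX : ∀ i, Measurable (X i))
    (hstat : IsStationary X) {k r : ℕ → ℕ} (hk : TailFraction k) (hA1 : CondA1 X k r)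
    {h : ℕ → ℝ → ℝ} (hh : ∀ n, Measurable (h n)) {C C' : ℝ}
    (hC : ∀ᶠ n in atTop, ∀ x, |h n x| ≤ C)
    (hC' : ∀ᶠ n : ℕ in atTop, ∫ ω, |h n (X 1 ω)| ≤ C' * (Real.sqrt (k n) / n))
    {η : ℝ} (hη : 0 < η) :
    Tendsto (fun n : ℕ => (ℙ : Measure Ω).real {ω | ∃ j ≤ n, η * Real.sqrt (k n) ≤
      |∑ i ∈ Finset.Icc 1 j, (h n (X i ω) - ∫ ω', h n (X 1 ω'))|}) atTop (nhds 0) := by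
  obtain ⟨hr, hβ, hrk⟩ := hA1
  have hs := hk.tendsto_sqrt_atTop
  have hC0 : 0 ≤ C := by
    obtain ⟨n, hn⟩ := hC.exists
    exact (abs_nonneg _).trans (hn 0)
  have hrs : Tendsto (fun n => (r n : ℝ) / Real.sqrt (k n)) atTop (nhds 0) := by
    have := hrk.sqrt
    rw [Real.sqrt_zero] at this
    refine this.congr fun n => ?_
    rw [Real.sqrt_div' _ (Nat.cast_nonneg _), Real.sqrt_sq (Nat.cast_nonneg _)]
  have hβ1 : Tendsto (fun n : ℕ => (n : ℝ) / r n * betaMix X (r n)) atTop (nhds 0) := by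
    refine (hβ 1 one_pos).congr fun n => ?_
    rw [one_mul, Nat.floor_natCast]
  have hbound : Tendsto (fun n : ℕ => 2 * (400 * C * C' / η ^ 2 * (r n / Real.sqrt (k n)) +
      40 * C / η * ((n / r n * betaMix X (r n)) * (r n / Real.sqrt (k n))))) atTop (nhds 0) := by
    simpa using ((hrs.const_mul _).add ((hβ1.mul hrs).const_mul _)).const_mul 2
  have hsmall : ∀ᶠ n in atTop, 20 * C * ((r n : ℝ) / Real.sqrt (k n)) < η := by
    have := hrs.const_mul (20 * C)
    rw [mul_zero] at this
    exact this.eventually_lt_const hη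
  refine squeeze_zero' (Eventually.of_forall fun n => measureReal_nonneg) ?_ hbound
  filter_upwards [hC, hC', hsmall, hs.eventually_gt_atTop 0, eventually_gt_atTop 0]
    with n h1 h2 h3 hs0 hn0
  have hn0' : (0 : ℝ) < n := Nat.cast_pos.2 hn0
  have hr0 : (0 : ℝ) < r n := Nat.cast_pos.2 (hr n)
  have hmain := measureReal_exists_le_abs_sum_le hX hstat (hh n) h1 (hr n) n
    (ε := η * Real.sqrt (k n) / 5) (by positivity) (by
      rw [← mul_div_assoc, div_lt_iff₀ hs0] at h3
      linarith)
  rw [mul_div_cancel₀ _ (by norm_num : (5 : ℝ) ≠ 0)] at hmain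
  refine hmain.trans ?_
  generalize Real.sqrt (k n) = s at *
  gcongr 2 * (?_ + ?_)
  · have : (n : ℝ) * r n * ∫ ω, |h n (X 1 ω)| ≤ r n * (C' * s) := by
      calc (n : ℝ) * r n * ∫ ω, |h n (X 1 ω)| ≤ n * r n * (C' * (s / n)) := by gcongr
        _ = _ := by field_simp
    calc 16 * C * (n * r n * ∫ ω, |h n (X 1 ω)|) / (η * s / 5) ^ 2
        ≤ 16 * C * (r n * (C' * s)) / (η * s / 5) ^ 2 := by gcongr
      _ = _ := by field_simp; ring
  · apply le_of_eq
    field_simp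
    ring

theorem log_sub_log_add_pos_iff {b x v : ℝ} (hb : 0 < b) (hv : v ≤ Real.log b) (hx : 0 ≤ x) :
    0 < Real.log x - Real.log b + v ↔ Real.exp (-v) * b < x := by
  have h1 : Real.exp (-v) * b = Real.exp (Real.log b - v) := by
    rw [sub_eq_neg_add, Real.exp_add, Real.exp_log hb]
  rw [h1]
  rcases hx.eq_or_lt with rfl | hx
  · rw [Real.log_zero]
    constructor
    · intro h; linarith
    · intro h; exact absurd h (Real.exp_pos _).not_gt
  · rw [← Real.lt_log_iff_exp_lt hx]
    constructor <;> intro h <;> linarith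

theorem integrable_indicator_Ioi {μ : Measure ℝ} [IsProbabilityMeasure μ] (a : ℝ) :
    Integrable ((Ioi a).indicator fun _ => (1 : ℝ)) μ :=
  (integrable_const 1).indicator measurableSet_Ioi

theorem integral_indicator_Ioi {μ : Measure ℝ} (a : ℝ) :
    ∫ x, (Ioi a).indicator (fun _ => (1 : ℝ)) x ∂μ = tailDF μ a := by
  rw [integral_indicator_const _ measurableSet_Ioi, smul_eq_mul, mul_one]
  rfl

theorem integral_abs_indicator_Ioi_sub_le (μ : Measure ℝ) [IsProbabilityMeasure μ] (a b : ℝ) :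
    ∫ x, |(Ioi a).indicator (fun _ => (1 : ℝ)) x - (Ioi b).indicator (fun _ => 1) x| ∂μ
      ≤ |tailDF μ a - tailDF μ b| := by
  have key : ∀ {a b : ℝ}, a ≤ b →
      ∫ x, |(Ioi a).indicator (fun _ => (1 : ℝ)) x - (Ioi b).indicator (fun _ => 1) x| ∂μ
        ≤ |tailDF μ a - tailDF μ b| := by
    intro a b hab
    have h1 : ∀ x, |(Ioi a).indicator (fun _ => (1 : ℝ)) x - (Ioi b).indicator (fun _ => 1) x|
        = (Ioi a).indicator (fun _ => (1 : ℝ)) x - (Ioi b).indicator (fun _ => 1) x := fun x =>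
      abs_of_nonneg (sub_nonneg.2 (indicator_le_indicator_of_subset (Ioi_subset_Ioi hab)
        (fun _ => zero_le_one) x))
    simp_rw [h1]
    rw [integral_sub (integrable_indicator_Ioi a) (integrable_indicator_Ioi b),
      integral_indicator_Ioi, integral_indicator_Ioi]
    exact le_abs_self _
  rcases le_total a b with hab | hab
  · exact key hab
  · rw [abs_sub_comm (tailDF μ a)]
    simp_rw [abs_sub_comm ((Ioi a).indicator (fun _ => (1 : ℝ)) _)]
    exact key hab

theorem measurable_phi1 : Measurable phi1 :=
  Measurable.ite measurableSet_Ioi measurable_const measurable_const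

theorem measurable_phi2 : Measurable phi2 := measurable_id.max measurable_const

theorem abs_phi1_sub_le (x y : ℝ) : |phi1 x - phi1 y| ≤ 1 := by
  unfold phi1
  split_ifs <;> norm_num

theorem abs_phi2_sub_le (x y : ℝ) : |phi2 x - phi2 y| ≤ |x - y| :=
  abs_max_sub_max_le_abs x y 0

theorem phi1_log_eq_indicator {b x v : ℝ} (hb : 0 < b) (hv : v ≤ Real.log b) (hx : 0 ≤ x) :
    phi1 (Real.log x - Real.log b + v)
      = (Ioi (Real.exp (-v) * b)).indicator (fun _ => (1 : ℝ)) x := by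
  simp only [phi1, log_sub_log_add_pos_iff hb hv hx, indicator, mem_Ioi]

theorem integral_abs_phi1_shift_le {μ : Measure ℝ} [IsProbabilityMeasure μ]
    (hμ : ∀ᵐ x ∂μ, 0 ≤ x) {b v : ℝ} (hb : 0 < b) (hv : |v| ≤ Real.log b) :
    ∫ x, |phi1 (Real.log x - Real.log b + v) - phi1 (Real.log x - Real.log b)| ∂μ
      ≤ |tailDF μ (Real.exp (-v) * b) - tailDF μ b| := by
  refine le_trans (le_of_eq ?_) (integral_abs_indicator_Ioi_sub_le μ _ _)
  refine integral_congr_ae ?_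
  filter_upwards [hμ] with x hx
  have h0 := phi1_log_eq_indicator hb ((abs_nonneg v).trans hv) hx
  rw [add_zero, neg_zero, Real.exp_zero, one_mul] at h0
  rw [h0, phi1_log_eq_indicator hb ((le_abs_self v).trans hv) hx]

theorem integral_abs_phi2_shift_le {μ : Measure ℝ} [IsProbabilityMeasure μ]
    (hμ : ∀ᵐ x ∂μ, 0 ≤ x) {b v : ℝ} (hb : 0 < b) (hv : |v| ≤ Real.log b) :
    ∫ x, |phi2 (Real.log x - Real.log b + v) - phi2 (Real.log x - Real.log b)| ∂μ
      ≤ |v| * tailDF μ (Real.exp (-|v|) * b) := by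
  rw [← integral_indicator_Ioi, ← integral_const_mul]
  refine integral_mono_of_nonneg (Eventually.of_forall fun x => abs_nonneg _)
    ((integrable_indicator_Ioi _).const_mul _) ?_
  filter_upwards [hμ] with x hx
  have h1 := abs_phi2_sub_le (Real.log x - Real.log b + v) (Real.log x - Real.log b)
  rw [add_sub_cancel_left] at h1
  by_cases hxb : Real.exp (-|v|) * b < x
  · simpa [indicator, hxb] using h1
  · have h2 := mt (log_sub_log_add_pos_iff hb hv hx).1 hxb
    have h3 := le_abs_self v
    have h4 := abs_nonneg v
    have h5 : phi2 (Real.log x - Real.log b + v) = 0 := max_eq_right (by linarith)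
    have h6 : phi2 (Real.log x - Real.log b) = 0 := max_eq_right (by linarith)
    simp [indicator, hxb, h5, h6]

theorem exists_eventually_shift_bounds {μ : Measure ℝ} [IsProbabilityMeasure μ]
    (hμ : ∀ᵐ x ∂μ, 0 ≤ x) {α : ℝ} (hα : 0 < α) {l : ℝ → ℝ} (hF : ParetoTail μ α l) {k : ℕ → ℕ}
    (hk : TailFraction k) {g : ℝ → ℝ} {K γ A : ℝ} (hA2 : CondA2 l g K γ A (quantileB μ) k)
    {φ : ℝ → ℝ} (hφ : φ = phi1 ∨ φ = phi2) (ζ : ℝ) :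
    ∃ C C', (∀ᶠ n : ℕ in atTop, ∀ x,
        |φ (Real.log x - Real.log (quantileB μ (n / k n)) + ζ / Real.sqrt (k n))
          - φ (Real.log x - Real.log (quantileB μ (n / k n)))| ≤ C) ∧
      ∀ᶠ n : ℕ in atTop,
        ∫ x, |φ (Real.log x - Real.log (quantileB μ (n / k n)) + ζ / Real.sqrt (k n))
          - φ (Real.log x - Real.log (quantileB μ (n / k n)))| ∂μ
          ≤ C' * (Real.sqrt (k n) / n) := by
  have hs := hk.tendsto_sqrt_atTop
  have hnk := hk.tendsto_div_atTop
  have hb : Tendsto (fun n : ℕ => quantileB μ (n / k n)) atTop atTop :=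
    (tendsto_quantileB_atTop μ hF.tailDF_pos).comp hnk
  have hv1 : ∀ᶠ n : ℕ in atTop, |ζ / Real.sqrt (k n)| ≤ |ζ| := by
    filter_upwards [hs.eventually_ge_atTop 1] with n hn
    rw [abs_div]
    exact div_le_self (abs_nonneg _) (hn.trans (le_abs_self _))
  have hlog : ∀ᶠ n : ℕ in atTop, |ζ / Real.sqrt (k n)| ≤ Real.log (quantileB μ (n / k n)) := by
    filter_upwards [hv1, (Real.tendsto_log_atTop.comp hb).eventually_ge_atTop |ζ|] with n h1 h2
    exact h1.trans h2
  rcases hφ with rfl | rfl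
  · obtain ⟨C, -, hC⟩ := exists_eventually_abs_tailDF_sub_le hα hF hk hA2 ζ
    refine ⟨1, C, Eventually.of_forall fun n x => abs_phi1_sub_le _ _, ?_⟩
    filter_upwards [hC, hb.eventually_gt_atTop 0, hlog] with n h1 h2 h3
    exact (integral_abs_phi1_shift_le hμ h2 h3).trans h1
  · obtain ⟨C, hC0, hC⟩ := exists_eventually_abs_tailDF_sub_le hα hF hk hA2 |ζ|
    refine ⟨|ζ|, |ζ| * (1 + C), ?_, ?_⟩
    · filter_upwards [hv1] with n h1 x
      refine (abs_phi2_sub_le _ _).trans ?_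
      rwa [add_sub_cancel_left]
    · filter_upwards [hC, hb.eventually_gt_atTop 0, hlog, hs.eventually_ge_atTop 1,
        hnk.eventually_gt_atTop 1] with n h1 h2 h3 h4 h5
      refine (integral_abs_phi2_shift_le hμ h2 h3).trans ?_
      have hsq : Real.sqrt (k n) * Real.sqrt (k n) = k n := Real.mul_self_sqrt (Nat.cast_nonneg _)
      have h6 : tailDF μ (quantileB μ (n / k n)) ≤ Real.sqrt (k n) * Real.sqrt (k n) / n := by
        rw [hsq]
        exact (tailDF_quantileB_le μ h5).trans_eq (inv_div _ _)
      have hs0 : 0 < Real.sqrt (k n) := by linarith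
      rw [abs_div, abs_of_pos hs0]
      have h7 := (abs_le.1 h1).2
      generalize tailDF μ _ = p at h7 ⊢
      generalize tailDF μ _ = q at h6 h7
      generalize Real.sqrt (k n) = s at *
      have h8 : p ≤ s * ((1 + C) * (s / n)) := by
        have h9 : C * (s / n) ≤ s * (C * (s / n)) :=
          le_mul_of_one_le_left (by positivity) h4
        have h10 : s * s / n = s * (s / n) := mul_div_assoc _ _ _
        linarith
      calc |ζ| / s * p ≤ |ζ| / s * (s * ((1 + C) * (s / n))) := by gcongr
        _ = _ := by field_simp

theorem ParetoTail.integrable_phi2_log {μ : Measure ℝ} [IsProbabilityMeasure μ]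
    (hμ : ∀ᵐ x ∂μ, 0 ≤ x) {α : ℝ} (hα : 0 < α) {l : ℝ → ℝ} (hF : ParetoTail μ α l) :
    Integrable (fun x => phi2 (Real.log x)) μ := by
  have hsum : Summable fun j : ℕ => tailDF μ (Real.exp j) := by
    refine summable_of_ratio_test_tendsto_lt_one (l := Real.exp (-α))
      (Real.exp_lt_one_iff.2 (neg_lt_zero.2 hα))
      (Eventually.of_forall fun j => (hF.tailDF_pos _).ne') ?_
    have h1 := (hF.1.2 _ (Real.exp_pos 1)).comp
      (Real.tendsto_exp_atTop.comp tendsto_natCast_atTop_atTop)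
    have h2 := h1.const_mul (Real.exp (-α))
    rw [mul_one] at h2
    refine h2.congr fun j => ?_
    have hj : Real.exp ((j + 1 : ℕ) : ℝ) = Real.exp 1 * Real.exp j := by
      rw [← Real.exp_add]
      push_cast
      ring_nf
    have hl := hF.slowlyVarying_pos (Real.exp_pos j)
    rw [Real.norm_of_nonneg (hF.tailDF_pos _).le, Real.norm_of_nonneg (hF.tailDF_pos _).le, hj,
      hF.2 _ (by positivity), hF.2 _ (Real.exp_pos _),
      Real.mul_rpow (Real.exp_pos _).le (Real.exp_pos _).le, ← Real.exp_mul 1, one_mul]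
    simp only [Function.comp]
    field_simp
  refine ⟨(measurable_phi2.comp Real.measurable_log).aestronglyMeasurable, ?_⟩
  have h0 : ∀ x, 0 ≤ phi2 (Real.log x) := fun x => le_max_right _ _
  rw [hasFiniteIntegral_iff_ofReal (Eventually.of_forall h0)]
  calc ∫⁻ x, ENNReal.ofReal (phi2 (Real.log x)) ∂μ
      ≤ ∫⁻ x, ∑' j : ℕ, (Ioi (Real.exp j)).indicator (fun _ => (1 : ENNReal)) x ∂μ := by
        refine lintegral_mono_ae ?_
        filter_upwards [hμ] with x hx
        rcases le_or_gt (Real.log x) 0 with h | h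
        · rw [phi2, max_eq_right h, ENNReal.ofReal_zero]
          exact zero_le
        have hx0 : 0 < x := hx.lt_of_ne (by rintro rfl; simp at h)
        rw [phi2, max_eq_left h.le]
        calc ENNReal.ofReal (Real.log x) ≤ ENNReal.ofReal ⌈Real.log x⌉₊ :=
              ENNReal.ofReal_le_ofReal (Nat.le_ceil _)
          _ = ∑ j ∈ Finset.range ⌈Real.log x⌉₊,
                (Ioi (Real.exp j)).indicator (fun _ => (1 : ENNReal)) x := by
              rw [Finset.sum_congr rfl (g := fun _ => 1)]
              · simp
              · intro j hj
                rw [Finset.mem_range, Nat.lt_ceil, Real.lt_log_iff_exp_lt hx0] at hj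
                exact indicator_of_mem (mem_Ioi.2 hj) _
          _ ≤ _ := ENNReal.sum_le_tsum _
    _ = ∑' j : ℕ, ENNReal.ofReal (tailDF μ (Real.exp j)) := by
        rw [lintegral_tsum fun j => (measurable_const.indicator measurableSet_Ioi).aemeasurable]
        refine tsum_congr fun j => ?_
        rw [lintegral_indicator_const measurableSet_Ioi, one_mul, tailDF,
          ENNReal.ofReal_toReal (measure_ne_top _ _)]
    _ < ⊤ := hsum.tsum_ofReal_lt_top

theorem ParetoTail.integrable_comp_log_add {μ : Measure ℝ} [IsProbabilityMeasure μ]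
    (hμ : ∀ᵐ x ∂μ, 0 ≤ x) {α : ℝ} (hα : 0 < α) {l : ℝ → ℝ} (hF : ParetoTail μ α l)
    {φ : ℝ → ℝ} (hφ : φ = phi1 ∨ φ = phi2) (b v : ℝ) :
    Integrable (fun x => φ (Real.log x - b + v)) μ := by
  have hm : Measurable fun x => Real.log x - b + v :=
    (Real.measurable_log.sub_const _).add_const _
  rcases hφ with rfl | rfl
  · refine Integrable.of_bound (measurable_phi1.comp hm).aestronglyMeasurable 1
      (Eventually.of_forall fun x => ?_)
    rw [Real.norm_eq_abs, phi1]
    split_ifs <;> norm_num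
  · refine ((hF.integrable_phi2_log hμ hα).add (integrable_const |v - b|)).mono'
      (measurable_phi2.comp hm).aestronglyMeasurable (Eventually.of_forall fun x => ?_)
    have h1 := abs_phi2_sub_le (Real.log x - b + v) (Real.log x)
    have h2 : Real.log x - b + v - Real.log x = v - b := by ring
    rw [h2] at h1
    have h3 : 0 ≤ phi2 (Real.log x - b + v) := le_max_right _ _
    rw [Real.norm_of_nonneg h3]
    have := (abs_le.1 h1).2
    simp only [Pi.add_apply]
    linarith

/-- A sequence dominated by the maximal partial sums scaled by `k^{-1/2}` is `o_P(1)` when these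
are. -/
theorem tendstoInMeasure_zero_of_dominated {Ω : Type*} [MeasureSpace Ω]
    [IsProbabilityMeasure (ℙ : Measure Ω)] {k : ℕ → ℕ} (hk : TailFraction k)
    {S : ℕ → ℕ → Ω → ℝ}
    (hS : ∀ η : ℝ, 0 < η → Tendsto (fun n : ℕ => (ℙ : Measure Ω).real
      {ω | ∃ j ≤ n, η * Real.sqrt (k n) ≤ |S n j ω|}) atTop (nhds 0))
    {Y : ℕ → Ω → ℝ} (hY : ∀ n ω c, 0 ≤ c → (∀ j ≤ n, |(Real.sqrt (k n))⁻¹ * S n j ω| ≤ c) →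
      |Y n ω| ≤ c) :
    TendstoInMeasure (ℙ : Measure Ω) Y atTop 0 := by
  rw [tendstoInMeasure_iff_norm]
  intro η hη
  have h1 := (ENNReal.tendsto_ofReal (hS (η / 2) (half_pos hη)))
  rw [ENNReal.ofReal_zero] at h1
  refine tendsto_of_tendsto_of_tendsto_of_le_of_le' tendsto_const_nhds h1
    (Eventually.of_forall fun n => zero_le) ?_
  filter_upwards [hk.tendsto_sqrt_atTop.eventually_gt_atTop 0] with n hs0
  rw [ofReal_measureReal]
  refine measure_mono fun ω hω => ?_
  by_contra hcon
  simp only [mem_ofPred_eq, not_exists, not_and, not_le] at hcon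
  have h2 := hY n ω (η / 2) (half_pos hη).le fun j hj => by
    rw [abs_mul, abs_of_pos (inv_pos.2 hs0), inv_mul_le_iff₀ hs0, mul_comm]
    exact (hcon j hj).le
  rw [mem_ofPred_eq, Pi.zero_apply, sub_zero, Real.norm_eq_abs] at hω
  linarith

/-- Lemma 3 of Kim–Lee (2009): under (A1)–(A3), `M_n(t, ζ) - M_n(t, 0) = o_P(1)` for each
`ζ` and `t ∈ [0,1]`, and `sup_{0≤t≤1} |M_n(t, ζ) - M_n(t, 0)| = o_P(1)`. -/
theorem tail_process_shift_negligible
    {Ω : Type*} [MeasureSpace Ω] [IsProbabilityMeasure (ℙ : Measure Ω)]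
    (X : ℕ → Ω → ℝ) (hmeas : ∀ i, Measurable (X i)) (hpos : ∀ i ω, 0 ≤ X i ω)
    (hstat : IsStationary X)
    (α : ℝ) (hα : 0 < α) (l : ℝ → ℝ)
    (hF : ParetoTail (Measure.map (X 1) (ℙ : Measure Ω)) α l)
    (k r : ℕ → ℕ) (hk : TailFraction k)
    (hA1 : CondA1 X k r)
    (g : ℝ → ℝ) (K γ A : ℝ)
    (hA2 : CondA2 l g K γ A (quantileB (Measure.map (X 1) (ℙ : Measure Ω))) k)
    (χ ωc : ℝ)
    (hA3 : CondA3 X (quantileB (Measure.map (X 1) (ℙ : Measure Ω))) k r α χ ωc)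
    (φ : ℝ → ℝ) (hφ : φ = phi1 ∨ φ = phi2) :
    (∀ ζ : ℝ, ∀ t ∈ Icc (0 : ℝ) 1,
      TendstoInMeasure (ℙ : Measure Ω)
        (fun n ω => Mn X (quantileB (Measure.map (X 1) (ℙ : Measure Ω))) φ n (k n) t ζ ω - Mn X (quantileB (Measure.map (X 1) (ℙ : Measure Ω))) φ n (k n) t 0 ω)
        atTop 0) ∧
    (∀ ζ : ℝ,
      TendstoInMeasure (ℙ : Measure Ω)
        (fun n ω => ⨆ t : Icc (0 : ℝ) 1,
          |Mn X (quantileB (Measure.map (X 1) (ℙ : Measure Ω))) φ n (k n) (t : ℝ) ζ ω - Mn X (quantileB (Measure.map (X 1) (ℙ : Measure Ω))) φ n (k n) (t : ℝ) 0 ω|)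
        atTop 0) := by
  obtain ⟨hμ, hμprob⟩ : (∀ᵐ x ∂(Measure.map (X 1) (ℙ : Measure Ω)), 0 ≤ x) ∧
      IsProbabilityMeasure (Measure.map (X 1) (ℙ : Measure Ω)) :=
    ⟨(ae_map_iff (hmeas 1).aemeasurable measurableSet_Ici).2 (Eventually.of_forall (hpos 1)),
      Measure.isProbabilityMeasure_map (hmeas 1).aemeasurable⟩
  set μ := Measure.map (X 1) (ℙ : Measure Ω) with hμdef
  have hφm : Measurable φ := by
    rcases hφ with rfl | rfl
    exacts [measurable_phi1, measurable_phi2]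
  set h : ℝ → ℕ → ℝ → ℝ := fun ζ n x =>
    φ (Real.log x - Real.log (quantileB μ (n / k n)) + ζ / Real.sqrt (k n))
      - φ (Real.log x - Real.log (quantileB μ (n / k n))) with hdef
  have hhm : ∀ ζ n, Measurable (h ζ n) := fun ζ n =>
    (hφm.comp ((Real.measurable_log.sub_const _).add_const _)).sub
      (hφm.comp (Real.measurable_log.sub_const _))
  set S : ℝ → ℕ → ℕ → Ω → ℝ := fun ζ n j ω =>
    ∑ i ∈ Finset.Icc 1 j, (h ζ n (X i ω) - ∫ ω', h ζ n (X 1 ω')) with hSdef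
  have hS : ∀ ζ η : ℝ, 0 < η → Tendsto (fun n : ℕ => (ℙ : Measure Ω).real
      {ω | ∃ j ≤ n, η * Real.sqrt (k n) ≤ |S ζ n j ω|}) atTop (nhds 0) := by
    intro ζ η hη
    obtain ⟨C, C', hC, hC'⟩ := exists_eventually_shift_bounds hμ hα hF hk hA2 hφ ζ
    refine tendsto_measureReal_exists_le_abs_sum hmeas hstat hk hA1 (hhm ζ) hC
      (C' := C') (hC'.mono fun n hn => ?_) hη
    rwa [hμdef, integral_map (hmeas 1).aemeasurable
      (hhm ζ n).abs.aestronglyMeasurable] at hn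
  have hdiff : ∀ ζ n t ω, Mn X (quantileB μ) φ n (k n) t ζ ω - Mn X (quantileB μ) φ n (k n) t 0 ω
      = (Real.sqrt (k n))⁻¹ * S ζ n ⌊(n : ℝ) * t⌋₊ ω := by
    intro ζ n t ω
    have hi : ∀ v, Integrable fun ω =>
        φ (Real.log (X 1 ω) - Real.log (quantileB μ (n / k n)) + v) := fun v =>
      (hF.integrable_comp_log_add hμ hα hφ _ v).comp_measurable (hmeas 1)
    have h0 := hi 0
    simp only [add_zero] at h0
    simp only [Mn, An, hSdef, hdef, zero_div, add_zero]
    rw [integral_sub (hi _) h0, ← mul_sub, ← Finset.sum_sub_distrib]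
    congr 1
    exact Finset.sum_congr rfl fun i _ => by ring
  have hfloor : ∀ (n : ℕ) {t : ℝ}, t ∈ Icc (0 : ℝ) 1 → ⌊(n : ℝ) * t⌋₊ ≤ n := fun n t ht =>
    Nat.floor_le_of_le (mul_le_of_le_one_right (Nat.cast_nonneg _) ht.2)
  refine ⟨fun ζ t ht => tendstoInMeasure_zero_of_dominated hk (hS ζ) fun n ω c _ hj => ?_,
    fun ζ => tendstoInMeasure_zero_of_dominated hk (hS ζ) fun n ω c hc hj => ?_⟩
  · rw [hdiff]
    exact hj _ (hfloor n ht)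
  · rw [abs_of_nonneg (Real.iSup_nonneg fun t => abs_nonneg _)]
    refine Real.iSup_le (fun t => ?_) hc
    rw [hdiff]
    exact hj _ (hfloor n t.2)

end TailCusum
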